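/- Let G be an Artin group with all labels m_{ij} ≥ 4, presented by the infinite presentation whose relators are all nontrivial cyclically reduced words in F(a_i, a_j) representing 1 in G_{ij} (over all pairs with m_{ij} < ∞). If w is a nontrivial freely reduced word in F(a₁,…,aₙ) representing the identity in G, then w contains a subword v such that v is also a subword of some relator r ∈ 𝓡_{ij} with r = vu, where the syllable length ‖u‖ ≤ 3 and ‖v‖ ≥ 2m_{ij} − 3. -/

import Mathlib

/-- The alternating word `x y x y ⋯` with `m` letters, in the free group. -/
def altWord {σ : Type*} (x y : σ) : ℕ → FreeGroup σ
  | 0 => 1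
  | m + 1 => FreeGroup.of x * altWord y x m

/-- The syllable length `‖w‖`: the number of maximal blocks of the form `a^n`
in the reduced word representing `w`. -/
def syll {σ : Type*} [DecidableEq σ] (w : FreeGroup σ) : ℕ :=
  ((w.toWord.map Prod.fst).destutter (· ≠ ·)).length

/-- An element of a free group is cyclically reduced if, in its reduced word, the
first letter is not the inverse of the last letter. -/
def CyclicallyReduced {σ : Type*} [DecidableEq σ] (w : FreeGroup σ) : Prop :=
  ∀ x y, w.toWord.head? = some x → w.toWord.getLast? = some y → x ≠ (y.1, !y.2)

/-- The defining relators `u_{ij} u_{ji}⁻¹` of the Artin group with Coxeter-type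
labels `M : Fin n → Fin n → ℕ∞` (relations with `M i j = ∞` are omitted). -/
def artinRels (n : ℕ) (M : Fin n → Fin n → ℕ∞) : Set (FreeGroup (Fin n)) :=
  { r | ∃ i j : Fin n, i ≠ j ∧ ∃ m : ℕ, M i j = (m : ℕ∞) ∧
      r = altWord i j m * (altWord j i m)⁻¹ }

/-- The quotient map from the free group onto the Artin group with labels `M`. -/
def artinMk (n : ℕ) (M : Fin n → Fin n → ℕ∞) :
    FreeGroup (Fin n) →* PresentedGroup (artinRels n M) :=
  PresentedGroup.mk _

/-- The quotient map from `F(a,b)` onto the two-generator Artin group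
`⟨a, b | aba⋯ = bab⋯⟩` with `m` letters on each side (`false ↦ a`, `true ↦ b`). -/
def twoGenArtinMk (m : ℕ) :
    FreeGroup Bool →* PresentedGroup
      ({ altWord false true m * (altWord true false m)⁻¹ } : Set (FreeGroup Bool)) :=
  PresentedGroup.mk _


structure Amal (ι : Type) where
  E : Type
  Γ : E → Type
  grp : ∀ e, Group (Γ e)
  mem : E → ι → Prop
  a : ∀ e, ι → Γ e
  join : ∀ i j, ∃ e, mem e i ∧ mem e j
  ne : ∀ e, ∃ i, mem e i
  uniq : ∀ e f i j, i ≠ j → mem e i → mem e j → mem f i → mem f j → e = f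
  two : ∀ e i j k, mem e i → mem e j → mem e k → i ≠ j → k = i ∨ k = j
  oth : ∀ e i, mem e i → ∃ k, mem e k ∧ k ≠ i
  girth : ∀ e i k, mem e i → mem e k → i ≠ k → ∀ p q r s : ℤ,
    a e i ^ p * a e k ^ q * a e i ^ r * a e k ^ s = 1 →
      (q = 0 ∧ s = 0 ∧ p + r = 0) ∨ (p = 0 ∧ r = 0 ∧ q + s = 0)

attribute [instance] Amal.grp

structure Stg {ι : Type} (S : Amal ι) where
  X : Type
  base : X
  root : S.E → X → X
  co : ∀ e, X → S.Γ e
  inj : ∀ e c c', root e c = root e c' → co e c = co e c' → c = c'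
  root_root : ∀ e c, root e (root e c) = root e c
  co_root : ∀ e c, co e (root e c) = 1
  pan : ∀ e f i n c c', S.mem e i → S.mem f i → root e c' = root e c →
    co e c' = co e c * S.a e i ^ (n : ℤ) →
    root f c' = root f c ∧ co f c' = co f c * S.a f i ^ (n : ℤ)
  pfull : ∀ e i (n : ℤ) c c', S.mem e i → root e c' = root e c →
    co e c' = co e c * S.a e i ^ n → n ≠ 0 → ∀ m : ℤ, ∃ c'', root e c'' = root e c ∧
      co e c'' = co e c * S.a e i ^ m
  shape : ∀ e d, root e d = d → (∀ g, ∃ c, root e c = d ∧ co e c = g) ∨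
    (∀ c, root e c = d → ∃ i, ∃ n : ℤ, S.mem e i ∧ co e c = S.a e i ^ n)

namespace Amal
variable {ι : Type} (S : Amal ι)

lemma zp {e i} (hi : S.mem e i) {n : ℤ} (h : S.a e i ^ n = 1) : n = 0 := by
  obtain ⟨k, hk, hki⟩ := S.oth e i hi
  have := S.girth e i k hi hk (Ne.symm hki) n 0 0 0 (by simpa using h)
  omega

lemma zpinj {e i} (hi : S.mem e i) {n m : ℤ} (h : S.a e i ^ n = S.a e i ^ m) : n = m := by
  have : S.a e i ^ (n - m) = 1 := by rw [zpow_sub, h]; group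
  have := S.zp hi this
  omega

/-- coincidence of powers of distinct generators -/
lemma zpne {e i k} (hi : S.mem e i) (hk : S.mem e k) (hik : i ≠ k) {n m : ℤ}
    (h : S.a e i ^ n = S.a e k ^ m) : n = 0 ∧ m = 0 := by
  have := S.girth e i k hi hk hik n (-m) 0 0 (by simp [h])
  omega

lemma zp2 {e i k j} (hi : S.mem e i) (hk : S.mem e k) (hj : S.mem e j) (hik : i ≠ k) {n m s : ℤ}
    (h : S.a e i ^ n * S.a e k ^ m = S.a e j ^ s) : n = 0 ∨ m = 0 := by
  rcases S.two e i k j hi hk hj hik with rfl | rfl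
  · have := S.girth e j k hi hk hik (-s) 0 n m (by simp [mul_assoc, h])
    omega
  · have := S.girth e i j hi hk hik n (m - s) 0 0 (by
      simp [zpow_sub, ← mul_assoc, h])
    omega
end Amal

namespace Stg
variable {ι : Type} {S : Amal ι} (T : Stg S)

def HasP (i : ι) (x : T.X) : Prop :=
  ∃ n : ℤ, n ≠ 0 ∧ ∃ c, ∀ e, S.mem e i → T.root e c = T.root e x ∧ T.co e c = T.co e x * S.a e i ^ n

lemma hasP_of {i x e c} {n : ℤ} (hi : S.mem e i) (hn : n ≠ 0) (h1 : T.root e c = T.root e x)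
    (h2 : T.co e c = T.co e x * S.a e i ^ n) : T.HasP i x :=
  ⟨n, hn, c, fun f hf => T.pan e f i n x c hi hf h1 h2⟩

lemma ex_adj {i x} (h : T.HasP i x) (m : ℤ) :
    ∃ c, ∀ e, S.mem e i → T.root e c = T.root e x ∧ T.co e c = T.co e x * S.a e i ^ m := by
  obtain ⟨n, hn, c, hc⟩ := h
  obtain ⟨e, he, -⟩ := S.join i i
  obtain ⟨c', h1, h2⟩ := T.pfull e i n x c he (hc e he).1 (hc e he).2 hn m
  exact ⟨c', fun f hf => T.pan e f i m x c' he hf h1 h2⟩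

lemma nh {i x e} (hi : S.mem e i) (h : ¬ T.HasP i x) :
    (∀ y, T.root e y = T.root e x → ∃ j, ∃ s : ℤ, S.mem e j ∧ T.co e y = S.a e j ^ s) ∧
    ∃ k, ∃ q : ℤ, S.mem e k ∧ k ≠ i ∧ T.co e x = S.a e k ^ q := by
  have hs : ∀ y, T.root e y = T.root e x → ∃ j, ∃ s : ℤ, S.mem e j ∧ T.co e y = S.a e j ^ s := by
    rcases T.shape e (T.root e x) (T.root_root e x) with h1 | h1
    · obtain ⟨c, hc, hc'⟩ := h1 (T.co e x * S.a e i ^ (1 : ℤ))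
      exact absurd (T.hasP_of hi one_ne_zero hc hc') h
    · exact h1
  refine ⟨hs, ?_⟩
  obtain ⟨j, s, hj, hjs⟩ := hs x rfl
  by_cases hji : j = i
  · subst hji
    by_cases hs0 : s = 0
    · subst hs0
      obtain ⟨k, hk, hki⟩ := S.oth e j hj
      exact ⟨k, 0, hk, hki, by simpa using hjs⟩
    · exfalso
      apply h
      refine T.hasP_of (c := T.root e x) (n := -s) hi (by omega) (T.root_root e x) ?_
      rw [T.co_root, hjs]; group
  · exact ⟨j, s, hj, hji, hjs⟩

lemma U {i k l e x y} {n m p : ℤ} (hi : S.mem e i) (hk : S.mem e k) (hl : S.mem e l) (hik : i ≠ k)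
    (h : ¬ T.HasP i x) (hn : n ≠ 0) (hy : T.root e y = T.root e x)
    (heq : T.co e x * S.a e i ^ n * S.a e k ^ m = T.co e y * S.a e l ^ p) : m = 0 := by
  obtain ⟨hs, k', q, hk', hki, hx⟩ := T.nh hi h
  obtain rfl : k' = k := by
    rcases S.two e i k k' hi hk hk' hik with h | h
    · exact absurd h hki
    · exact h
  obtain ⟨j, s, hj, hys⟩ := hs y hy
  have hx' := hx
  rw [hx, hys] at heq
  have G := S.girth e k' i hk hi hki
  rcases S.two e i k' l hi hk hl hik with rfl | rfl <;>
  rcases S.two e _ _ j hi hk hj hik with rfl | rfl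
  · have := G q n m (-p - s) (by
      rw [zpow_sub, zpow_neg, ← mul_assoc, heq, ← zpow_add]
      group)
    omega
  · have := G (q - s) n m (-p) (by
      have : S.a e j ^ (q - s) * S.a e l ^ n * S.a e j ^ m * S.a e l ^ (-p)
        = S.a e j ^ (-s) * (S.a e j ^ q * S.a e l ^ n * S.a e j ^ m) * S.a e l ^ (-p) := by group
      rw [this, heq]; group)
    omega
  · have := G q n (m - p) (-s) (by
      have : S.a e l ^ q * S.a e j ^ n * S.a e l ^ (m - p) * S.a e j ^ (-s)
        = (S.a e l ^ q * S.a e j ^ n * S.a e l ^ m) * S.a e l ^ (-p) * S.a e j ^ (-s) := by group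
      rw [this, heq]; group)
    rcases this with h' | ⟨h1, h2, h3⟩
    · omega
    · exfalso
      apply h
      refine T.hasP_of (c := y) (n := n) hi hn hy ?_
      rw [hys, hx', h1, show s = n by omega]; group
  · have := G q n (m - p - s) 0 (by
      have : S.a e j ^ q * S.a e i ^ n * S.a e j ^ (m - p - s) * S.a e i ^ (0:ℤ)
        = (S.a e j ^ q * S.a e i ^ n * S.a e j ^ m) * S.a e j ^ (-p) * S.a e j ^ (-s) := by group
      rw [this, heq]; group)
    omega

def InY (e : S.E) (d : T.X) (g : S.Γ e) : Prop :=
  ∃ x i, ∃ n : ℤ, T.root e x = d ∧ S.mem e i ∧ g = T.co e x * S.a e i ^ n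

inductive Nx : Type
  | old (x : T.X) : Nx
  | A (x : T.X) (i : ι) (n : ℤ) (h : ¬ T.HasP i x) (hn : n ≠ 0) : Nx
  | B (d : T.X) (e : S.E) (g : S.Γ e) (hd : T.root e d = d) (hg : ¬ T.InY e d g) : Nx

open Classical in
noncomputable def stp (i : ι) (n : ℤ) (x : T.X) : T.Nx :=
  if hn : n = 0 then .old x else
  if h : T.HasP i x then .old (T.ex_adj h n).choose else .A x i n h hn

lemma stp_old {e i c x} {n : ℤ} (hi : S.mem e i) (h1 : T.root e c = T.root e x)
    (h2 : T.co e c = T.co e x * S.a e i ^ n) : T.stp i n x = .old c := by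
  unfold stp
  split_ifs with hn hp
  · subst hn; congr 1; exact T.inj e _ _ h1.symm (by simp [h2])
  · congr 1
    have := (T.ex_adj hp n).choose_spec e hi
    exact T.inj e _ _ (by rw [this.1, h1]) (by rw [this.2, h2])
  · exact absurd (T.hasP_of hi hn h1 h2) hp

/-- either the step stays old or is a genuinely new panel element -/
lemma stp_cases (i : ι) (n : ℤ) (x : T.X) :
    (∃ c, T.stp i n x = .old c ∧ ∀ e, S.mem e i → T.root e c = T.root e x ∧ T.co e c = T.co e x * S.a e i ^ n) ∨
    (∃ h hn, T.stp i n x = .A x i n h hn) := by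
  unfold stp
  split_ifs with hn hp
  · left; exact ⟨x, rfl, fun e _ => ⟨rfl, by simp [hn]⟩⟩
  · left; exact ⟨_, rfl, (T.ex_adj hp n).choose_spec⟩
  · right; exact ⟨hp, hn, rfl⟩

lemma stp_eq {e i l x y} {n p : ℤ} (hi : S.mem e i) (hl : S.mem e l) (hy : T.root e y = T.root e x)
    (heq : T.co e x * S.a e i ^ n = T.co e y * S.a e l ^ p) : T.stp i n x = T.stp l p y := by
  rcases T.stp_cases i n x with ⟨c, hc, h⟩ | ⟨h, hn, hA⟩
  · rw [hc]
    exact (T.stp_old hl ((h e hi).1.trans hy.symm) (by rw [(h e hi).2, heq])).symm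
  rcases T.stp_cases l p y with ⟨c, hc, h'⟩ | ⟨h', hn', hA'⟩
  · rw [hc]
    exact (T.stp_old hi ((h' e hl).1.trans hy) (by rw [(h' e hl).2, heq]))
  by_cases hil : i = l
  · subst hil
    by_cases hnp : n = p
    · subst hnp
      have := T.inj e x y hy.symm (by simpa using heq)
      subst this; rfl
    · exfalso; apply h
      refine T.hasP_of (c := y) (n := n - p) hi (by omega) hy ?_
      rw [zpow_sub, ← mul_assoc, heq]; group
  · exfalso; apply hn'
    have := T.U (m := -p) (p := 0) hi hl hi hil h hn hy (by rw [heq]; group)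
    omega

open Classical in
noncomputable def Bch (e : S.E) (d : T.X) (hd : T.root e d = d) (g : S.Γ e) : T.Nx :=
  if h : T.InY e d g then T.stp h.choose_spec.choose h.choose_spec.choose_spec.choose h.choose
  else .B d e g hd h

lemma Bch_stp {e d i x} {n : ℤ} (hd : T.root e d = d) (hx : T.root e x = d) (hi : S.mem e i) :
    T.Bch e d hd (T.co e x * S.a e i ^ n) = T.stp i n x := by
  have h : T.InY e d (T.co e x * S.a e i ^ n) := ⟨x, i, n, hx, hi, rfl⟩
  unfold Bch
  rw [dif_pos h]
  have h3 := h.choose_spec.choose_spec.choose_spec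
  exact T.stp_eq h3.2.1 hi (hx.trans h3.1.symm) h3.2.2.symm

lemma Bch_B {e d g} (hd : T.root e d = d) (h : ¬ T.InY e d g) : T.Bch e d hd g = .B d e g hd h := by
  unfold Bch; rw [dif_neg h]

lemma Bch_old {e d x} (hd : T.root e d = d) (hx : T.root e x = d) :
    T.Bch e d hd (T.co e x) = .old x := by
  obtain ⟨i, hi⟩ : ∃ i, S.mem e i := S.ne e
  have := T.Bch_stp (n := 0) hd hx hi
  simpa [stp] using this

end Stg

namespace Stg
variable {ι : Type} {S : Amal ι} (T : Stg S)

noncomputable def rep (f : S.E) (d : T.X) (i : ι) (g : S.Γ f) : S.Γ f :=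
  Classical.epsilon (fun r => (∃ n : ℤ, r = g * S.a f i ^ n) ∧
    ((∃ n : ℤ, T.InY f d (g * S.a f i ^ n)) → T.InY f d r))

noncomputable def xp (f : S.E) (d : T.X) (i : ι) (g : S.Γ f) : ℤ :=
  Classical.epsilon (fun n : ℤ => g = T.rep f d i g * S.a f i ^ n)

lemma rep_spec (f : S.E) (d : T.X) (i : ι) (g : S.Γ f) :
    (∃ n : ℤ, T.rep f d i g = g * S.a f i ^ n) ∧
    ((∃ n : ℤ, T.InY f d (g * S.a f i ^ n)) → T.InY f d (T.rep f d i g)) := by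
  apply Classical.epsilon_spec (p := fun r => (∃ n : ℤ, r = g * S.a f i ^ n) ∧
    ((∃ n : ℤ, T.InY f d (g * S.a f i ^ n)) → T.InY f d r))
  by_cases h : ∃ n : ℤ, T.InY f d (g * S.a f i ^ n)
  · obtain ⟨n, hn⟩ := h
    exact ⟨_, ⟨n, rfl⟩, fun _ => hn⟩
  · exact ⟨g, ⟨0, by simp⟩, fun h' => absurd h' h⟩

lemma rep_mul (f : S.E) (d : T.X) (i : ι) (g : S.Γ f) (m : ℤ) :
    T.rep f d i (g * S.a f i ^ m) = T.rep f d i g := by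
  unfold rep
  congr 1
  funext r
  have h1 : (∃ n : ℤ, r = g * S.a f i ^ m * S.a f i ^ n) ↔ ∃ n : ℤ, r = g * S.a f i ^ n := by
    constructor
    · rintro ⟨n, h⟩; exact ⟨m + n, by rw [h, zpow_add, mul_assoc]⟩
    · rintro ⟨n, h⟩; exact ⟨n - m, by rw [h, mul_assoc, ← zpow_add]; congr 2; omega⟩
  have h2 : (∃ n : ℤ, T.InY f d (g * S.a f i ^ m * S.a f i ^ n)) ↔
      ∃ n : ℤ, T.InY f d (g * S.a f i ^ n) := by
    constructor
    · rintro ⟨n, h⟩; exact ⟨m + n, by rwa [zpow_add, ← mul_assoc]⟩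
    · rintro ⟨n, h⟩
      refine ⟨n - m, ?_⟩
      rw [mul_assoc, ← zpow_add, show m + (n - m) = n by omega]; exact h
  rw [h1, h2]

lemma xp_spec (f : S.E) (d : T.X) (i : ι) (g : S.Γ f) :
    g = T.rep f d i g * S.a f i ^ T.xp f d i g := by
  apply Classical.epsilon_spec (p := fun n : ℤ => g = T.rep f d i g * S.a f i ^ n)
  obtain ⟨n, hn⟩ := (T.rep_spec f d i g).1
  exact ⟨-n, by rw [hn]; group⟩

lemma xp_eq {f : S.E} {d : T.X} {i : ι} {g : S.Γ f} {n : ℤ} (hi : S.mem f i)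
    (h : g = T.rep f d i g * S.a f i ^ n) : T.xp f d i g = n := by
  have h' := T.xp_spec f d i g
  apply S.zpinj hi
  exact mul_left_cancel (h'.symm.trans h)

lemma xp_mul {f : S.E} {d : T.X} {i : ι} {g : S.Γ f} (n : ℤ) (hi : S.mem f i) :
    T.xp f d i (g * S.a f i ^ n) = T.xp f d i g + n := by
  apply T.xp_eq hi
  rw [rep_mul, zpow_add, ← mul_assoc, ← T.xp_spec f d i g]

lemma rep_rep (f : S.E) (d : T.X) (i : ι) (g : S.Γ f) :
    T.rep f d i (T.rep f d i g) = T.rep f d i g := by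
  conv_rhs => rw [T.xp_spec f d i g, rep_mul]

open Classical in
noncomputable def nroot (e : S.E) : T.Nx → T.Nx
  | .old x => .old (T.root e x)
  | .A x i n h hn => if S.mem e i then .old (T.root e x) else .A x i n h hn
  | .B d f g hd hg => if f = e then .old d else
      if h : ∃ i, S.mem e i ∧ S.mem f i then T.Bch f d hd (T.rep f d h.choose g) else .B d f g hd hg

open Classical in
noncomputable def nco (e : S.E) : T.Nx → S.Γ e
  | .old x => T.co e x
  | .A x i n _ _ => if S.mem e i then T.co e x * S.a e i ^ n else 1
  | .B d f g _ _ => if h : f = e then h ▸ g else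
      if h : ∃ i, S.mem e i ∧ S.mem f i then S.a e h.choose ^ (T.xp f d h.choose g) else 1

lemma nB_ne {e f d g hd hg i} (hef : f ≠ e) (he : S.mem e i) (hf : S.mem f i) :
    T.nroot e (.B d f g hd hg) = T.Bch f d hd (T.rep f d i g) ∧
    T.nco e (.B d f g hd hg) = S.a e i ^ T.xp f d i g := by
  have h : ∃ i, S.mem e i ∧ S.mem f i := ⟨i, he, hf⟩
  have hc : h.choose = i := by
    by_contra hne
    exact hef (S.uniq f e _ i hne h.choose_spec.2 hf h.choose_spec.1 he)
  simp only [nroot, nco, if_neg hef, dif_neg hef, dif_pos h, hc, and_self]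

lemma stp_spec {e i} (n : ℤ) (x : T.X) (hi : S.mem e i) :
    T.nroot e (T.stp i n x) = .old (T.root e x) ∧
    T.nco e (T.stp i n x) = T.co e x * S.a e i ^ n := by
  rcases T.stp_cases i n x with ⟨c, hc, h⟩ | ⟨h, hn, hA⟩
  · rw [hc]; simp [nroot, nco, (h e hi).1, (h e hi).2]
  · rw [hA]; simp [nroot, nco, hi]

lemma Bch_root {e d} (hd : T.root e d = d) (g : S.Γ e) :
    T.nroot e (T.Bch e d hd g) = .old d ∧ T.nco e (T.Bch e d hd g) = g := by
  by_cases h : T.InY e d g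
  · obtain ⟨x, i, n, hx, hi, rfl⟩ := h
    rw [T.Bch_stp hd hx hi]
    have := T.stp_spec n x hi
    rw [hx] at this; exact this
  · rw [T.Bch_B hd h]; simp [nroot, nco]

def Free (f : S.E) (d : T.X) (i : ι) (g : S.Γ f) : Prop :=
  ¬ ∃ x, ∃ m : ℤ, T.root f x = d ∧ g = T.co f x * S.a f i ^ m

lemma Free.mul {f : S.E} {d : T.X} {i : ι} {g : S.Γ f} (h : T.Free f d i g) (n : ℤ) :
    T.Free f d i (g * S.a f i ^ n) := by
  rintro ⟨x, m, hx, hg⟩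
  refine h ⟨x, m - n, hx, ?_⟩
  rw [zpow_sub, ← mul_assoc, ← hg]; group

lemma Free.rep {f : S.E} {d : T.X} {i : ι} {g : S.Γ f} (h : T.Free f d i g) :
    T.Free f d i (T.rep f d i g) := by
  obtain ⟨n, hn⟩ := (T.rep_spec f d i g).1
  rw [hn]; exact h.mul T n

lemma free_of_not {f : S.E} {d : T.X} {i : ι} {g : S.Γ f} (hi : S.mem f i) (h : ¬ T.InY f d g) :
    T.Free f d i g := by
  rintro ⟨x, m, hx, hg⟩
  exact h ⟨x, i, m, hx, hi, hg⟩

lemma Free.not_old {f : S.E} {d : T.X} {i : ι} {g : S.Γ f} (h : T.Free f d i g)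
    (hd : T.root f d = d) (c : T.X) : T.Bch f d hd g ≠ .old c := by
  intro hc
  have := T.Bch_root hd g
  rw [hc] at this
  simp only [nroot, nco, Nx.old.injEq] at this
  exact h ⟨c, 0, this.1, by simp [this.2]⟩

lemma K1 {e f d i} {g : S.Γ f} (hd : T.root f d = d) (hef : f ≠ e) (he : S.mem e i) (hf : S.mem f i)
    (h : T.Free f d i g) :
    T.nroot e (T.Bch f d hd g) = T.Bch f d hd (T.rep f d i g) ∧
    T.nco e (T.Bch f d hd g) = S.a e i ^ T.xp f d i g := by
  by_cases hY : T.InY f d g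
  · have hY' := hY
    obtain ⟨x, j, n, hx, hj, hg⟩ := hY
    have hji : j ≠ i := by
      rintro rfl; exact h ⟨x, n, hx, hg⟩
    have hB : T.Bch f d hd g = T.stp j n x := by rw [hg]; exact T.Bch_stp hd hx hj
    rcases T.stp_cases j n x with ⟨c, hc, -⟩ | ⟨hP, hn, hA⟩
    · exact absurd (hB.trans hc) (h.not_old T hd c)
    have hr : T.rep f d i g = g := by
      obtain ⟨⟨m, hm⟩, h2⟩ := T.rep_spec f d i g
      obtain ⟨y, l, p, hy, hl, hrep⟩ := h2 ⟨0, by simpa using hY'⟩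
      have : m = 0 := by
        refine T.U (p := p) hj hf hl hji hP hn (hy.trans hx.symm) ?_
        rw [← hrep, hm, hg]
      rw [hm, this]; simp
    have hx0 : T.xp f d i g = 0 := T.xp_eq hf (by rw [hr]; simp)
    have hej : ¬ S.mem e j := fun hej => hef (S.uniq f e j i hji hj hf hej he)
    rw [hr, hx0, hB, hA]
    simp [nroot, nco, hej]
  · rw [T.Bch_B hd hY]; exact T.nB_ne hef he hf

lemma mvspec {e f d i} (g : S.Γ f) (n : ℤ) (hd : T.root f d = d) (he : S.mem e i) (hf : S.mem f i) :
    T.nroot e (T.Bch f d hd (g * S.a f i ^ n)) = T.nroot e (T.Bch f d hd g) ∧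
    T.nco e (T.Bch f d hd (g * S.a f i ^ n)) = T.nco e (T.Bch f d hd g) * S.a e i ^ n := by
  by_cases hef : f = e
  · subst hef
    simp [(T.Bch_root hd _).1, (T.Bch_root hd _).2]
  by_cases h : T.Free f d i g
  · have h1 := T.K1 hd hef he hf h
    have h2 := T.K1 hd hef he hf (h.mul T n)
    rw [h1.1, h1.2, h2.1, h2.2, rep_mul, xp_mul T n hf, zpow_add]
    simp
  · unfold Free at h
    push Not at h
    obtain ⟨x, m, hx, hg⟩ := h
    have e1 : g * S.a f i ^ n = T.co f x * S.a f i ^ (m + n) := by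
      rw [hg, mul_assoc, ← zpow_add]
    rw [e1, hg, T.Bch_stp hd hx hf, T.Bch_stp hd hx hf, (T.stp_spec _ x he).1, (T.stp_spec _ x he).1,
      (T.stp_spec _ x he).2, (T.stp_spec _ x he).2, zpow_add, mul_assoc]
    simp

lemma Bch_eq_B {f d hd e d'} {g : S.Γ f} {g' : S.Γ e} {hd' hg'}
    (h : T.Bch f d hd g = .B d' e g' hd' hg') : f = e := by
  by_cases hY : T.InY f d g
  · obtain ⟨x, j, n, hx, hj, hg⟩ := hY
    rw [hg, T.Bch_stp hd hx hj] at h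
    rcases T.stp_cases j n x with ⟨c, hc, -⟩ | ⟨hP, hn, hA⟩
    · rw [hc] at h; cases h
    · rw [hA] at h; cases h
  · rw [T.Bch_B hd hY] at h
    injection h

lemma R1 {e c d} (h : T.nroot e c = .old d) :
    ∃ hd : T.root e d = d, c = T.Bch e d hd (T.nco e c) := by
  cases c with
  | old x =>
    simp only [nroot, Nx.old.injEq] at h
    subst h
    exact ⟨T.root_root e x, (T.Bch_old _ rfl).symm⟩
  | A x i n hP hn =>
    simp only [nroot] at h
    split_ifs at h with hi
    simp only [Nx.old.injEq] at h
    subst h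
    refine ⟨T.root_root e x, ?_⟩
    simp only [nco, hi, if_true]
    rw [T.Bch_stp _ rfl hi]
    simp [stp, hn, hP]
  | B d' f g hd hg =>
    by_cases hfe : f = e
    · subst hfe
      simp only [nroot, if_true, Nx.old.injEq] at h
      subst h
      refine ⟨hd, ?_⟩
      simp [nco, T.Bch_B hd hg]
    · exfalso
      by_cases hs : ∃ i, S.mem e i ∧ S.mem f i
      · obtain ⟨i, hei, hfi⟩ := hs
        rw [(T.nB_ne hfe hei hfi).1] at h
        exact ((T.free_of_not hfi hg).rep T).not_old T hd d h
      · simp [nroot, hfe, hs] at h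

lemma R2 {e c} (h : ∀ d, T.nroot e c ≠ .old d) :
    (c = T.nroot e c ∧ T.nco e c = 1) ∨
    ∃ i f d g hd hg, c = .B d f g hd hg ∧ f ≠ e ∧ S.mem e i ∧ S.mem f i ∧
      T.nroot e c = T.Bch f d hd (T.rep f d i g) ∧ T.nco e c = S.a e i ^ T.xp f d i g := by
  cases c with
  | old x => exact absurd rfl (h (T.root e x))
  | A x i n hP hn =>
    by_cases hi : S.mem e i
    · exact absurd (by simp [nroot, hi]) (h (T.root e x))
    · left; simp [nroot, nco, hi]
  | B d f g hd hg =>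
    by_cases hfe : f = e
    · subst hfe
      exact absurd (by simp [nroot]) (h d)
    by_cases hs : ∃ i, S.mem e i ∧ S.mem f i
    · right
      obtain ⟨i, hei, hfi⟩ := hs
      exact ⟨i, f, d, g, hd, hg, rfl, hfe, hei, hfi, T.nB_ne hfe hei hfi⟩
    · left; simp [nroot, nco, hfe, hs]

lemma xp0 {f d i} {g : S.Γ f} (h : T.xp f d i g = 0) : T.rep f d i g = g := by
  have := T.xp_spec f d i g
  rw [h] at this; simpa using this.symm

lemma ninj (e : S.E) (c c' : T.Nx) (h : T.nroot e c = T.nroot e c') (h2 : T.nco e c = T.nco e c') :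
    c = c' := by
  by_cases ho : ∃ d, T.nroot e c = .old d
  · obtain ⟨d, hd⟩ := ho
    obtain ⟨_, h3⟩ := T.R1 hd
    obtain ⟨_, h4⟩ := T.R1 (h ▸ hd)
    rw [h3, h4, h2]
  · push Not at ho
    have ho' : ∀ d, T.nroot e c' ≠ .old d := by rwa [← h]
    have key : ∀ c : T.Nx, T.nco e c = 1 → (∀ d, T.nroot e c ≠ .old d) → c = T.nroot e c := by
      intro c hc ho
      rcases T.R2 ho with ⟨h1, -⟩ | ⟨i, f, d, g, hd, hg, rfl, hfe, hei, hfi, hr, hx⟩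
      · exact h1
      · rw [hx] at hc
        have := T.xp0 (S.zp hei hc)
        rw [hr, this, T.Bch_B hd hg]
    by_cases h1 : T.nco e c = 1
    · rw [key c h1 ho, key c' (h2 ▸ h1) ho', h]
    rcases T.R2 ho with ⟨_, h1'⟩ | ⟨i, f, d, g, hd, hg, rfl, hfe, hei, hfi, hr, hx⟩
    · exact absurd h1' h1
    rcases T.R2 ho' with ⟨_, h1'⟩ | ⟨i', f', d', g', hd', hg', rfl, hfe', hei', hfi', hr', hx'⟩
    · exact absurd (h2.trans h1') h1
    have hii : i = i' := by
      by_contra hne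
      have := S.zpne hei hei' hne (hx.symm.trans (h2.trans hx'))
      rw [hx, this.1] at h1
      simp at h1
    subst hii
    have hxx : T.xp f d i g = T.xp f' d' i g' := S.zpinj hei (hx.symm.trans (h2.trans hx'))
    have hrr := hr.symm.trans (h.trans hr')
    by_cases hff : f' = f
    · subst hff
      have b1 := T.Bch_root hd (T.rep f' d i g)
      have b2 := T.Bch_root hd' (T.rep f' d' i g')
      rw [hrr] at b1
      have hdd : d = d' := by
        have := b1.1.symm.trans b2.1
        injection this
      subst hdd
      have hre := b1.2.symm.trans b2.2
      have : g = g' := by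
        rw [T.xp_spec f' d i g, T.xp_spec f' d i g', hre, hxx]
      subst this; rfl
    · exfalso
      have b1 := (T.Bch_root hd (T.rep f d i g)).1
      rw [hrr, (T.K1 hd' hff hfi hfi' ((T.free_of_not hfi' hg').rep T)).1] at b1
      exact (((T.free_of_not hfi' hg').rep T).rep T).not_old T hd' d b1

lemma nroot_root (e : S.E) (c : T.Nx) : T.nroot e (T.nroot e c) = T.nroot e c ∧
    T.nco e (T.nroot e c) = 1 := by
  by_cases ho : ∃ d, T.nroot e c = .old d
  · obtain ⟨d, hd⟩ := ho
    obtain ⟨h1, _⟩ := T.R1 hd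
    rw [hd]
    refine ⟨by simp [nroot, h1], ?_⟩
    simp only [nco]; rw [← h1]; exact T.co_root e d
  · push Not at ho
    rcases T.R2 ho with ⟨h1, h2⟩ | ⟨i, f, d, g, hd, hg, rfl, hfe, hei, hfi, hr, hx⟩
    · rw [← h1]; exact ⟨h1.symm, h2⟩
    · have := T.K1 hd hfe hei hfi ((T.free_of_not hfi hg).rep T)
      rw [hr, this.1, this.2, rep_rep]
      refine ⟨rfl, ?_⟩
      rw [T.xp_eq (n := 0) hfi (by simp [rep_rep])]; simp

lemma Mv (c : T.Nx) (i : ι) : (∃ f d hd g, S.mem f i ∧ c = T.Bch f d hd g) ∨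
    (∃ d f g hd hg, c = .B d f g hd hg ∧ ¬ S.mem f i) := by
  cases c with
  | old x =>
    obtain ⟨f, hf, -⟩ := S.join i i
    exact Or.inl ⟨f, T.root f x, T.root_root f x, T.co f x, hf, (T.Bch_old _ rfl).symm⟩
  | A x j n h hn =>
    obtain ⟨f, hf, hj⟩ := S.join i j
    refine Or.inl ⟨f, T.root f x, T.root_root f x, T.co f x * S.a f j ^ n, hf, ?_⟩
    rw [T.Bch_stp _ rfl hj]; simp [stp, h, hn]
  | B d f g hd hg =>
    by_cases hf : S.mem f i
    · exact Or.inl ⟨f, d, hd, g, hf, (T.Bch_B hd hg).symm⟩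
    · exact Or.inr ⟨d, f, g, hd, hg, rfl, hf⟩

lemma Tr {d f g hd hg e i c'} {n : ℤ} (hf : ¬ S.mem f i) (he : S.mem e i)
    (h1 : T.nroot e c' = T.nroot e (.B d f g hd hg))
    (h2 : T.nco e c' = T.nco e (.B d f g hd hg) * S.a e i ^ n) : n = 0 := by
  have hfe : f ≠ e := by rintro rfl; exact hf he
  by_cases hs : ∃ j, S.mem e j ∧ S.mem f j
  · obtain ⟨j, hej, hfj⟩ := hs
    have hji : j ≠ i := by rintro rfl; exact hf hfj
    obtain ⟨hr, hx⟩ := T.nB_ne (g := g) (hd := hd) (hg := hg) hfe hej hfj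
    have hno : ∀ d, T.nroot e c' ≠ .old d := by
      intro d'; rw [h1, hr]; exact ((T.free_of_not hfj hg).rep T).not_old T hd d'
    rw [hx] at h2
    rw [hr] at h1
    rcases T.R2 hno with ⟨-, h3⟩ | ⟨l, f', d', g', hd', hg', rfl, hfe', hel, hfl, hr', hx'⟩
    · rw [h3] at h2
      have := S.zp2 (s := 0) hej he hej hji (by rw [← h2]; simp)
      rcases this with h0 | h0
      · rw [h0] at h2
        exact S.zp he (by simpa using h2.symm)
      · exact h0
    · rw [hx'] at h2
      rcases S.zp2 hej he hel hji h2.symm with h0 | h0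
      · rw [h0] at h2
        by_cases hli : l = i
        · exfalso
          subst hli
          rw [T.xp0 h0, T.Bch_B hd hg, hr'] at h1
          exact hf (T.Bch_eq_B h1 ▸ hfl)
        · exact (S.zpne hel he hli (by simpa using h2)).2
      · exact h0
  · have hr : T.nroot e (.B d f g hd hg) = .B d f g hd hg := by simp [nroot, hfe, hs]
    have hx : T.nco e (.B d f g hd hg) = 1 := by simp [nco, hfe, hs]
    rw [hr] at h1; rw [hx] at h2
    have hno : ∀ d, T.nroot e c' ≠ .old d := by
      intro d'; rw [h1]; exact fun h => by cases h
    rcases T.R2 hno with ⟨-, h3⟩ | ⟨l, f', d', g', hd', hg', rfl, hfe', hel, hfl, hr', hx'⟩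
    · rw [h3] at h2
      exact S.zp he (by simpa using h2.symm)
    · rw [hr'] at h1
      exact absurd ⟨l, hel, T.Bch_eq_B h1 ▸ hfl⟩ hs

noncomputable def next : Stg S where
  X := T.Nx
  base := .old T.base
  root := T.nroot
  co := T.nco
  inj := T.ninj
  root_root e c := (T.nroot_root e c).1
  co_root e c := (T.nroot_root e c).2
  pan := by
    intro e f i n c c' he hf h1 h2
    rcases T.Mv c i with ⟨f0, d, hd, g, hf0, rfl⟩ | ⟨d, f0, g, hd, hg, rfl, hf0⟩
    · have := T.mvspec g n hd he hf0
      have hc : c' = T.Bch f0 d hd (g * S.a f0 i ^ n) :=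
        T.ninj e _ _ (h1.trans this.1.symm) (h2.trans this.2.symm)
      rw [hc]
      exact T.mvspec g n hd hf hf0
    · have := T.Tr hf0 he h1 h2
      subst this
      have hc := T.ninj e _ _ h1 (by simpa using h2)
      rw [hc]; simp
  pfull := by
    intro e i n c c' he h1 h2 hn m
    rcases T.Mv c i with ⟨f0, d, hd, g, hf0, rfl⟩ | ⟨d, f0, g, hd, hg, rfl, hf0⟩
    · exact ⟨_, T.mvspec g m hd he hf0⟩
    · exact absurd (T.Tr hf0 he h1 h2) hn
  shape := by
    intro e ρ hρ
    by_cases ho : ∃ d, ρ = .old d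
    · left
      obtain ⟨d, rfl⟩ := ho
      have hd : T.root e d = d := by
        simpa [nroot] using hρ
      exact fun g => ⟨_, T.Bch_root hd g⟩
    · right
      push Not at ho
      intro c hc
      have hno : ∀ d, T.nroot e c ≠ .old d := by rw [hc]; exact ho
      rcases T.R2 hno with ⟨-, h3⟩ | ⟨l, f', d', g', hd', hg', rfl, hfe', hel, hfl, hr', hx'⟩
      · obtain ⟨i, hi⟩ := S.ne e
        exact ⟨i, 0, hi, by simp [h3]⟩
      · exact ⟨l, _, hel, hx'⟩

end Stg

def sg (b : Bool) : ℤ := if b then 1 else -1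

lemma sg_ne (b : Bool) : sg b ≠ 0 := by cases b <;> simp [sg]

def zl {ι : Type} (i : ι) (n : ℤ) : List (ι × Bool) :=
  List.replicate n.natAbs (i, decide (0 < n))

lemma mk_letter {ι : Type} (i : ι) (b : Bool) :
    FreeGroup.mk [(i, b)] = FreeGroup.of i ^ sg b := by
  cases b
  · simp [sg, FreeGroup.of, FreeGroup.inv_mk, FreeGroup.invRev]
  · simp [sg, FreeGroup.of]

lemma mk_rep {ι : Type} (i : ι) (b : Bool) (k : ℕ) :
    FreeGroup.mk (List.replicate k (i, b)) = FreeGroup.of i ^ (sg b * k) := by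
  induction k with
  | zero => simp [FreeGroup.one_eq_mk]
  | succ k ih =>
    rw [List.replicate_succ, ← List.singleton_append, ← FreeGroup.mul_mk, ih, mk_letter,
      ← zpow_add]
    congr 1; push_cast; ring

lemma mk_zl {ι : Type} (i : ι) (n : ℤ) : FreeGroup.mk (zl i n) = FreeGroup.of i ^ n := by
  unfold zl
  rw [mk_rep]
  congr 1
  unfold sg
  by_cases h : 0 < n
  · simp only [h, decide_true, if_true]; omega
  · simp only [h, decide_false]; rw [if_neg (by simp)]; omega

lemma zl_fst {ι : Type} {i : ι} {n : ℤ} {p : ι × Bool} (h : p ∈ zl i n) : p.1 = i := by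
  unfold zl at h
  rw [(List.mem_replicate.1 h).2]

lemma zl_red {ι : Type} (i : ι) (n : ℤ) : FreeGroup.IsReduced (zl i n) := by
  unfold zl FreeGroup.IsReduced
  apply List.isChain_replicate_of_rel
  simp

lemma zl_app_red {ι : Type} {k : ι} {n : ℤ} {v : List (ι × Bool)} (hv : FreeGroup.IsReduced v)
    (h : ∀ p ∈ v.head?, p.1 ≠ k) : FreeGroup.IsReduced (zl k n ++ v) := by
  have h1 := zl_red k n
  unfold FreeGroup.IsReduced at *
  rw [List.isChain_append]
  refine ⟨h1, hv, ?_⟩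
  intro x hx y hy hxy
  exact absurd (hxy.symm.trans (zl_fst (List.mem_of_getLast? hx))) (h y hy)

lemma zl_head {ι : Type} {k : ι} {n : ℤ} (hn : n ≠ 0) (v : List (ι × Bool)) :
    ∃ b, (zl k n ++ v).head? = some (k, b) := by
  unfold zl
  obtain ⟨m, hm⟩ : ∃ m, n.natAbs = m + 1 := ⟨n.natAbs - 1, by omega⟩
  rw [hm, List.replicate_succ]
  exact ⟨_, rfl⟩

open Classical in
lemma red_eq {ι : Type} {u v : List (ι × Bool)} (hu : FreeGroup.IsReduced u)
    (hv : FreeGroup.IsReduced v) (h : FreeGroup.mk u = FreeGroup.mk v) : u = v := by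
  have := FreeGroup.reduce.sound h
  rwa [hu.reduce_eq, hv.reduce_eq] at this

/-- a reduced list with both letters equal to a product of two powers -/
lemma two_form {ι : Type} {i j l k : ι} {v : List (ι × Bool)} {q s p : ℤ}
    (hv : FreeGroup.IsReduced v) (hik : i ≠ k) (hh : ∃ b, v.head? = some (i, b))
    (hk : ∃ b, (k, b) ∈ v) (hj : j = i ∨ j = k) (hl : l = i ∨ l = k)
    (h : FreeGroup.of k ^ q * FreeGroup.mk v = FreeGroup.of j ^ s * FreeGroup.of l ^ p) :
    q = 0 ∧ j = i ∧ l = k ∧ s ≠ 0 ∧ p ≠ 0 := by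
  classical
  obtain ⟨b, hb⟩ := hh
  obtain ⟨b', hb'⟩ := hk
  have hiv : (i, b) ∈ v := List.mem_of_mem_head? hb
  have hred : FreeGroup.IsReduced (zl k q ++ v) := zl_app_red hv (by
    intro p hp; rw [hb] at hp; simp at hp; subst hp; exact hik)
  rw [← mk_zl, FreeGroup.mul_mk] at h
  have one : ∀ t n, FreeGroup.mk (zl k q ++ v) ≠ FreeGroup.of t ^ (n : ℤ) := by
    intro t n ht
    rw [← mk_zl] at ht
    have := red_eq hred (zl_red _ _) ht
    have h1 : (i, b) ∈ zl t n := by rw [← this]; simp [hiv]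
    have h2 : (k, b') ∈ zl t n := by rw [← this]; simp [hb']
    exact hik ((zl_fst h1).trans (zl_fst h2).symm)
  have hs : s ≠ 0 := by rintro rfl; exact one l p (by simpa using h)
  have hp : p ≠ 0 := by rintro rfl; exact one j s (by simpa using h)
  have hjl : j ≠ l := by rintro rfl; exact one j (s + p) (by rw [h, zpow_add])
  have e : zl k q ++ v = zl j s ++ zl l p := by
    apply red_eq hred
    · apply zl_app_red (zl_red _ _)
      intro x hx
      rw [zl_fst (List.mem_of_mem_head? hx)]; exact hjl.symm
    · rw [h, ← FreeGroup.mul_mk, mk_zl, mk_zl]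
  obtain ⟨b2, hb2⟩ := zl_head (k := j) hs (zl l p)
  by_cases hq : q = 0
  · subst hq
    simp only [zl, Int.natAbs_zero, List.replicate_zero, List.nil_append] at e
    rw [e] at hb
    unfold zl at hb2
    rw [hb2] at hb
    simp only [Option.some.injEq, Prod.mk.injEq] at hb
    refine ⟨rfl, hb.1, ?_, hs, hp⟩
    rcases hl with rfl | rfl
    · exact absurd hb.1 hjl
    · rfl
  · exfalso
    obtain ⟨b3, hb3⟩ := zl_head (k := k) hq v
    rw [e, hb2] at hb3
    simp only [Option.some.injEq, Prod.mk.injEq] at hb3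
    have hjk := hb3.1
    subst hjk
    have hli : l = i := by
      rcases hl with h | h
      · exact h
      · exact absurd h.symm hjl
    subst hli
    have d1 : (zl j q ++ v).dropWhile (fun x => decide (x.1 = j)) = v := by
      rw [List.dropWhile_append_of_pos (by intro x hx; simpa using zl_fst hx)]
      cases v with
      | nil => rfl
      | cons x v => simp at hb; subst hb; simp [hik]
    have d2 : (zl j s ++ zl l p).dropWhile (fun x => decide (x.1 = j)) = zl l p := by
      rw [List.dropWhile_append_of_pos (by intro x hx; simpa using zl_fst hx)]
      cases h0 : zl l p with
      | nil => rfl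
      | cons x v' =>
        have : x.1 = l := zl_fst (n := p) (by rw [h0]; simp)
        simp [this, hik]
    rw [e, d2] at d1
    rw [← d1] at hb'
    exact hik (zl_fst hb').symm

namespace Amal
variable {ι : Type} (S : Amal ι)

def ev (e : S.E) (L : List (ι × Bool)) : S.Γ e := (L.map fun p => S.a e p.1 ^ sg p.2).prod

lemma ev_snoc (e : S.E) (L : List (ι × Bool)) (p : ι × Bool) :
    S.ev e (L ++ [p]) = S.ev e L * S.a e p.1 ^ sg p.2 := by
  simp [ev]

lemma ev_lift (e : S.E) (L : List (ι × Bool)) :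
    S.ev e L = FreeGroup.lift (S.a e) (FreeGroup.mk L) := by
  induction L with
  | nil => simp [ev, FreeGroup.one_eq_mk.symm]
  | cons p L ih =>
    rw [← List.singleton_append, ← FreeGroup.mul_mk, map_mul, ← ih, mk_letter]
    simp [ev]

def Dehn (L : List (ι × Bool)) : Prop :=
  ∃ e v, v <:+: L ∧ (∀ p ∈ v, S.mem e p.1) ∧ ∃ j₁ j₂ j₃, ∃ n₁ n₂ n₃ : ℤ,
    S.mem e j₁ ∧ S.mem e j₂ ∧ S.mem e j₃ ∧
    S.ev e v = S.a e j₁ ^ n₁ * S.a e j₂ ^ n₂ * S.a e j₃ ^ n₃ ∧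
    FreeGroup.mk v ≠ FreeGroup.of j₁ ^ n₁ * FreeGroup.of j₂ ^ n₂ * FreeGroup.of j₃ ^ n₃

lemma Dehn.mono {L L' : List (ι × Bool)} (h : S.Dehn L) (h' : L <:+: L') : S.Dehn L' := by
  obtain ⟨e, v, hv, r⟩ := h
  exact ⟨e, v, hv.trans h', r⟩
end Amal

namespace Stg
variable {ι : Type} {S : Amal ι} (T : Stg S)

def Adj (p : ι × Bool) (c c' : T.X) : Prop :=
  ∀ e, S.mem e p.1 → T.root e c' = T.root e c ∧ T.co e c' = T.co e c * S.a e p.1 ^ sg p.2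

def Path : T.X → List (ι × Bool) → T.X → Prop
  | c, [], c' => c = c'
  | c, p :: L, c' => ∃ d, T.Adj p c d ∧ Path d L c'

lemma Adj.uniq {p c d d'} (h : T.Adj p c d) (h' : T.Adj p c d') : d = d' := by
  obtain ⟨e, he, -⟩ := S.join p.1 p.1
  exact T.inj e _ _ ((h e he).1.trans (h' e he).1.symm) ((h e he).2.trans (h' e he).2.symm)

lemma adj_stp (p : ι × Bool) (n : ℤ) (x : T.X) :
    T.next.Adj p (T.stp p.1 n x) (T.stp p.1 (n + sg p.2) x) := by
  intro e he
  have h1 := T.stp_spec n x he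
  have h2 := T.stp_spec (n + sg p.2) x he
  change T.nroot e _ = T.nroot e _ ∧ T.nco e _ = T.nco e _ * _
  rw [h1.1, h2.1, h1.2, h2.2, zpow_add, mul_assoc]
  simp

lemma adj_Bch {f d} (hd : T.root f d = d) (p : ι × Bool) (hp : S.mem f p.1) (g : S.Γ f) :
    T.next.Adj p (T.Bch f d hd g) (T.Bch f d hd (g * S.a f p.1 ^ sg p.2)) := by
  intro e he
  exact T.mvspec g (sg p.2) hd he hp

lemma stp_zero (i : ι) (x : T.X) : T.stp i 0 x = .old x := by simp [stp]

/-- returning to `Y` -/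
lemma retY {e x i v} (hi : S.mem e i) (hP : ¬ T.HasP i x) (hv : FreeGroup.IsReduced v)
    (hve : ∀ p ∈ v, S.mem e p.1) (hh : ∃ b, v.head? = some (i, b)) (hk : ∃ p ∈ v, p.1 ≠ i)
    (hY : T.InY e (T.root e x) (T.co e x * S.ev e v)) : S.Dehn v := by
  obtain ⟨y, l, p, hy, hl, heq⟩ := hY
  obtain ⟨hs, k, q, hk', hki, hx⟩ := T.nh hi hP
  obtain ⟨j, s, hj, hys⟩ := hs y hy
  obtain ⟨⟨k2, b⟩, hkv, hk2⟩ := hk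
  have hkk : k2 = k := by
    rcases S.two e i k k2 hi hk' (hve _ hkv) hki.symm with h | h
    · exact absurd h hk2
    · exact h
  subst hkk
  refine ⟨e, v, List.infix_rfl, hve, k2, j, l, -q, s, p, hk', hj, hl, ?_, ?_⟩
  · rw [mul_assoc, ← hys, ← heq, hx]; group
  · intro hcon
    obtain ⟨hq, rfl, rfl, hs0, hp0⟩ := two_form (q := q) (s := s) (p := p) (j := j) (l := l) hv hki.symm hh ⟨b, hkv⟩
      (S.two e i k2 j hi hk' hj hki.symm) (S.two e i k2 l hi hk' hl hki.symm)
      (by rw [hcon]; group)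
    refine hp0 (T.U (p := p) hj hl hl hki.symm hP hs0 hy ?_)
    rw [hx, hys, hq]; simp

lemma pathB {e x i y} (hi : S.mem e i) (hP : ¬ T.HasP i x) (L : List (ι × Bool)) :
    ∀ v : List (ι × Bool), FreeGroup.IsReduced (v ++ L) → (∀ p ∈ v, S.mem e p.1) →
    (∃ b, v.head? = some (i, b)) → (∃ p ∈ v, p.1 ≠ i) →
    T.next.Path (T.Bch e (T.root e x) (T.root_root e x) (T.co e x * S.ev e v)) L (.old y) →
    S.Dehn (v ++ L) := by
  induction L with
  | nil =>
    intro v hv hve hh hk hp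
    by_cases hY : T.InY e (T.root e x) (T.co e x * S.ev e v)
    · simpa using T.retY hi hP (by simpa using hv) hve hh hk hY
    · change _ = _ at hp
      rw [T.Bch_B _ hY] at hp
      cases hp
  | cons p L ih =>
    intro v hv hve hh hk hp
    by_cases hY : T.InY e (T.root e x) (T.co e x * S.ev e v)
    · exact (T.retY hi hP (hv.infix (List.prefix_append _ _).isInfix) hve hh hk hY).mono S
        (List.prefix_append _ _).isInfix
    obtain ⟨d, hd, hp⟩ := hp
    have hpe : S.mem e p.1 := by
      by_contra hpe
      rw [T.Bch_B _ hY] at hd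
      obtain ⟨f, hf, -⟩ := S.join p.1 p.1
      exact sg_ne p.2 (T.Tr hpe hf (hd f hf).1 (hd f hf).2)
    have hdd := Adj.uniq T.next hd (T.adj_Bch _ p hpe _)
    rw [hdd, mul_assoc, ← S.ev_snoc] at hp
    have := ih (v ++ [p]) (by simpa using hv) (by
        intro q hq
        rcases List.mem_append.1 hq with h | h
        · exact hve q h
        · simp at h; rw [h]; exact hpe) (by
        obtain ⟨b, hb⟩ := hh
        exact ⟨b, by rw [List.head?_append, hb]; rfl⟩) (by
        obtain ⟨q, hq, hq'⟩ := hk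
        exact ⟨q, by simp [hq], hq'⟩) hp
    simpa using this

lemma pathA {x i b y} (hP : ¬ T.HasP i x) (L : List (ι × Bool)) :
    ∀ k : ℕ, FreeGroup.IsReduced (List.replicate (k + 1) (i, b) ++ L) →
    T.next.Path (T.stp i (sg b * (k + 1 : ℕ)) x) L (.old y) →
    S.Dehn (List.replicate (k + 1) (i, b) ++ L) := by
  have hne : ∀ k : ℕ, sg b * (k + 1 : ℕ) ≠ 0 := fun k =>
    mul_ne_zero (sg_ne b) (by positivity)
  induction L with
  | nil =>
    intro k hv hp
    change _ = _ at hp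
    rw [stp, dif_neg (hne k), dif_neg hP] at hp
    cases hp
  | cons p L ih =>
    intro k hv hp
    obtain ⟨d, hd, hp⟩ := hp
    by_cases hpi : p.1 = i
    · have hpb : p.2 = b := by
        unfold FreeGroup.IsReduced at hv
        rw [List.isChain_append] at hv
        exact (hv.2.2 (i, b) (by simp [List.getLast?_replicate]) p (by simp) hpi.symm).symm
      have hpp : p = (i, b) := Prod.ext hpi hpb
      have h1 := T.adj_stp p (sg b * (k + 1 : ℕ)) x
      rw [hpi] at h1
      have hdd := Adj.uniq T.next hd h1
      have e1 : sg b * (k + 1 : ℕ) + sg p.2 = sg b * (k + 1 + 1 : ℕ) := by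
        rw [hpb]; push_cast; ring
      rw [hdd, e1] at hp
      have e2 : List.replicate (k + 1) (i, b) ++ p :: L = List.replicate (k + 1 + 1) (i, b) ++ L := by
        rw [List.replicate_succ' (n := k + 1), hpp]; simp
      rw [e2] at hv ⊢
      exact ih (k + 1) hv hp
    · obtain ⟨e, hi, hk⟩ := S.join i p.1
      have e3 : T.co e x * S.a e i ^ (sg b * (k + 1 : ℕ)) =
          T.co e x * S.ev e (List.replicate (k + 1) (i, b)) := by
        rw [S.ev_lift, mk_rep]; simp
      rw [← T.Bch_stp (T.root_root e x) rfl hi, e3] at hd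
      have hdd := Adj.uniq T.next hd (T.adj_Bch _ p hk _)
      rw [hdd, mul_assoc, ← S.ev_snoc] at hp
      have := T.pathB hi hP L _ (by simpa using hv) (by
        intro q hq
        rcases List.mem_append.1 hq with h | h
        · rw [(List.mem_replicate.1 h).2]; exact hi
        · simp at h; rw [h]; exact hk) ⟨b, by simp [List.replicate_succ]⟩ ⟨p, by simp, hpi⟩ hp
      simpa using this

lemma pathO (L : List (ι × Bool)) : ∀ x y, FreeGroup.IsReduced L →
    T.next.Path (.old x) L (.old y) → T.Path x L y ∨ S.Dehn L := by
  induction L with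
  | nil =>
    intro x y _ h
    left
    change Nx.old x = Nx.old y at h
    injection h
  | cons p L ih =>
    intro x y hL hp
    obtain ⟨d, hd, hp⟩ := hp
    have h1 := T.adj_stp p 0 x
    rw [stp_zero, zero_add] at h1
    have hdd := Adj.uniq T.next hd h1
    rcases T.stp_cases p.1 (sg p.2) x with ⟨c, hc, h⟩ | ⟨hP, hn, hA⟩
    · rw [hdd, hc] at hp
      rcases ih c y (hL.infix (List.suffix_cons _ _).isInfix) hp with h' | h'
      · exact Or.inl ⟨c, h, h'⟩
      · exact Or.inr (h'.mono S (List.suffix_cons _ _).isInfix)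
    · right
      have := T.pathA (i := p.1) (b := p.2) (y := y) hP L 0 (by simpa using hL)
        (by simpa [hdd] using hp)
      simpa using this

lemma path_old {x y} (L : List (ι × Bool)) (h : T.Path x L y) : T.next.Path (.old x) L (.old y) := by
  induction L generalizing x with
  | nil => exact congrArg Nx.old h
  | cons p L ih =>
    obtain ⟨d, hd, hp⟩ := h
    refine ⟨.old d, ?_, ih hp⟩
    intro e he
    have := hd e he
    exact ⟨congrArg Nx.old this.1, this.2⟩

lemma path_snoc {x y z p} (L : List (ι × Bool)) (h : T.Path x L y) (h2 : T.Adj p y z) :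
    T.Path x (L ++ [p]) z := by
  induction L generalizing x with
  | nil => cases h; exact ⟨z, h2, rfl⟩
  | cons p L ih =>
    obtain ⟨d, hd, hp⟩ := h
    exact ⟨d, hd, ih hp⟩

variable (S) in
def zero : Stg S where
  X := Unit
  base := ()
  root _ c := c
  co _ _ := 1
  inj := fun _ _ _ _ _ => rfl
  root_root := fun _ _ => rfl
  co_root := fun _ _ => rfl
  pan := by
    intro e f i n c c' he hf _ h
    have := S.zp he (by simpa using h.symm)
    simp [this]
  pfull := by
    intro e i n c c' he _ h hn
    exact absurd (S.zp he (by simpa using h.symm)) hn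
  shape := by
    intro e d _
    right
    intro c _
    obtain ⟨i, hi⟩ := S.ne e
    exact ⟨i, 0, hi, by simp⟩

variable (S) in
noncomputable def st : ℕ → Stg S
  | 0 => zero S
  | t + 1 => (st t).next

lemma dehn_of_path (t : ℕ) {L : List (ι × Bool)} (hL : FreeGroup.IsReduced L) (h0 : L ≠ [])
    (h : (st S t).Path (st S t).base L (st S t).base) : S.Dehn L := by
  induction t with
  | zero =>
    exfalso
    cases L with
    | nil => exact h0 rfl
    | cons p L =>
      obtain ⟨d, hd, -⟩ := h
      obtain ⟨e, he, -⟩ := S.join p.1 p.1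
      have h3 : (1 : S.Γ e) = 1 * S.a e p.1 ^ sg p.2 := (hd e he).2
      exact sg_ne p.2 (S.zp he (by simpa using h3.symm))
  | succ t ih =>
    rcases (st S t).pathO L _ _ hL h with h' | h'
    · exact ih h'
    · exact h'

end Stg

namespace Stg
variable {ι : Type} (S : Amal ι)

def lrel (p q : Σ t, (st S t).X) : Prop := q = ⟨p.1 + 1, Nx.old p.2⟩

def Xinf : Type := Quot (lrel S)

def cls (t : ℕ) (x : (st S t).X) : Xinf S := Quot.mk _ ⟨t, x⟩

lemma cls_old (t : ℕ) (x : (st S t).X) : cls S t x = cls S (t + 1) (Nx.old x) :=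
  Quot.sound rfl

noncomputable def bch (t : ℕ) (e : S.E) (x : (st S t).X) (g : S.Γ e) : (st S (t + 1)).X :=
  (st S t).Bch e ((st S t).root e x) ((st S t).root_root e x) g

def up (t : ℕ) (x : (st S t).X) : (st S (t + 1)).X := Nx.old x

lemma cls_up (t : ℕ) (x : (st S t).X) : cls S (t + 1) (up S t x) = cls S t x := (cls_old S t x).symm

lemma bch_root (t : ℕ) (e : S.E) (x : (st S t).X) (g : S.Γ e) :
    (st S (t + 1)).root e (bch S t e x g) = up S t ((st S t).root e x) ∧
    (st S (t + 1)).co e (bch S t e x g) = g := (st S t).Bch_root ((st S t).root_root e x) g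

lemma bch_old (t : ℕ) (e : S.E) (x y : (st S t).X) (h : (st S t).root e y = (st S t).root e x) :
    bch S t e x ((st S t).co e y) = up S t y := (st S t).Bch_old _ h

lemma cls_Bch (t : ℕ) (e : S.E) (x : (st S t).X) (g h : S.Γ e) :
    cls S (t + 1 + 1) (bch S (t + 1) e (bch S t e x g) ((st S (t + 1)).co e (bch S t e x g) * h)) =
    cls S (t + 1) (bch S t e x (g * h)) := by
  have h1 := bch_root S t e x g
  have h2 := bch_root S t e x (g * h)
  rw [h1.2, ← cls_up S (t + 1), ← bch_old S (t + 1) e (bch S t e x g) _ (h2.1.trans h1.1.symm), h2.2]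

noncomputable def act (e : S.E) (g : S.Γ e) : Xinf S → Xinf S :=
  Quot.lift (fun p => cls S (p.1 + 1) (bch S p.1 e p.2 ((st S p.1).co e p.2 * g))) (by
    rintro ⟨t, x⟩ q rfl
    have h := cls_Bch S t e x ((st S t).co e x) g
    rw [bch_old S t e x x rfl] at h
    exact h.symm)

lemma act_cls (e : S.E) (g : S.Γ e) (t : ℕ) (x : (st S t).X) :
    act S e g (cls S t x) = cls S (t + 1) (bch S t e x ((st S t).co e x * g)) := rfl

lemma act_mul (e : S.E) (g h : S.Γ e) (z : Xinf S) : act S e h (act S e g z) = act S e (g * h) z := by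
  obtain ⟨⟨t, x⟩⟩ := z
  change act S e h (act S e g (cls S t x)) = act S e (g * h) (cls S t x)
  rw [act_cls, act_cls, act_cls, cls_Bch, mul_assoc]

lemma act_one (e : S.E) (z : Xinf S) : act S e 1 z = z := by
  obtain ⟨⟨t, x⟩⟩ := z
  change act S e 1 (cls S t x) = cls S t x
  rw [act_cls, mul_one, bch_old S t e x x rfl, cls_up]

lemma act_indep {e f : S.E} {i : ι} (he : S.mem e i) (hf : S.mem f i) :
    act S e (S.a e i) = act S f (S.a f i) := by
  funext z
  obtain ⟨⟨t, x⟩⟩ := z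
  change act S e _ (cls S t x) = act S f _ (cls S t x)
  have h1 := (st S t).Bch_stp (n := 1) ((st S t).root_root e x) rfl he
  have h2 := (st S t).Bch_stp (n := 1) ((st S t).root_root f x) rfl hf
  rw [zpow_one] at h1 h2
  rw [act_cls, act_cls]
  unfold bch
  rw [h1, h2]

noncomputable def Hom0 (e : S.E) : S.Γ e →* (Function.End (Xinf S))ᵐᵒᵖ where
  toFun g := MulOpposite.op (act S e g)
  map_one' := by
    have : act S e 1 = (1 : Function.End (Xinf S)) := funext (act_one S e)
    rw [this]; rfl
  map_mul' g h := by
    have : act S e (g * h) = (act S e h ∘ act S e g) := funext fun z => (act_mul S e g h z).symm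
    exact congrArg MulOpposite.op this

noncomputable def Hm (e : S.E) : S.Γ e →* ((Function.End (Xinf S))ᵐᵒᵖ)ˣ := (Hom0 S e).toHomUnits

def appl (u : ((Function.End (Xinf S))ᵐᵒᵖ)ˣ) (z : Xinf S) : Xinf S := (u : (Function.End (Xinf S))ᵐᵒᵖ).unop z

lemma appl_mul (u v : ((Function.End (Xinf S))ᵐᵒᵖ)ˣ) (z : Xinf S) :
    appl S (u * v) z = appl S v (appl S u z) := rfl

lemma appl_Hm (e : S.E) (g : S.Γ e) (z : Xinf S) : appl S (Hm S e g) z = act S e g z := rfl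

noncomputable def Phi : FreeGroup ι →* ((Function.End (Xinf S))ᵐᵒᵖ)ˣ :=
  FreeGroup.lift fun i => Hm S (S.join i i).choose (S.a _ i)

lemma Phi_of {e : S.E} {i : ι} (he : S.mem e i) : Phi S (FreeGroup.of i) = Hm S e (S.a e i) := by
  unfold Phi
  rw [FreeGroup.lift_apply_of]
  ext1
  exact congrArg MulOpposite.op (act_indep S (S.join i i).choose_spec.1 he)

lemma path_ex (L : List (ι × Bool)) : ∃ s c, cls S s c = appl S (Phi S (FreeGroup.mk L)) (cls S 0 (st S 0).base)
    ∧ (st S s).Path (st S s).base L c := by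
  induction L using List.reverseRecOn with
  | nil => exact ⟨0, (st S 0).base, rfl, rfl⟩
  | append_singleton L p ih =>
    obtain ⟨s, c, hc, hp⟩ := ih
    obtain ⟨e, he, -⟩ := S.join p.1 p.1
    refine ⟨s + 1, bch S s e c ((st S s).co e c * S.a e p.1 ^ sg p.2), ?_, ?_⟩
    · rw [← act_cls, hc, ← FreeGroup.mul_mk, map_mul, appl_mul, mk_letter, map_zpow, Phi_of S he,
        ← map_zpow, appl_Hm]
    · refine (st S (s + 1)).path_snoc L ((st S s).path_old L hp) ?_
      have := (st S s).adj_Bch ((st S s).root_root e c) p he ((st S s).co e c)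
      rw [(st S s).Bch_old _ rfl] at this
      exact this

def isB : Xinf S → Prop :=
  Quot.lift (fun p => p.2 = (st S p.1).base) (by
    rintro ⟨t, x⟩ q rfl
    apply propext
    constructor
    · rintro h; exact congrArg Nx.old h
    · intro h
      change Nx.old x = Nx.old (st S t).base at h
      injection h)

lemma Phi_dehn {L : List (ι × Bool)} (hL : FreeGroup.IsReduced L) (h0 : L ≠ [])
    (h : Phi S (FreeGroup.mk L) = 1) : S.Dehn L := by
  obtain ⟨s, c, hc, hp⟩ := path_ex S L
  rw [h] at hc
  have hc' : cls S s c = cls S 0 (st S 0).base := hc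
  have : isB S (cls S s c) := by rw [hc']; exact rfl
  have hb : c = (st S s).base := this
  rw [hb] at hp
  exact dehn_of_path s hL h0 hp

end Stg

namespace Dih

noncomputable def th (m : ℕ) : ℝ := Real.pi / m
noncomputable def lam (m : ℕ) : ℝ := 2 * Real.cos (th m)
noncomputable def Sn (m j : ℕ) : ℝ := Real.sin (j * th m)

lemma Sn_rec (m j : ℕ) : Sn m (j + 2) = lam m * Sn m (j + 1) - Sn m j := by
  unfold Sn lam
  have h1 : ((j + 2 : ℕ) : ℝ) * th m = ((j + 1 : ℕ) : ℝ) * th m + th m := by push_cast; ring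
  have h2 : ((j : ℕ) : ℝ) * th m = ((j + 1 : ℕ) : ℝ) * th m - th m := by push_cast; ring
  rw [h1, h2, Real.sin_add, Real.sin_sub]; ring

lemma Sn_zero (m : ℕ) : Sn m 0 = 0 := by simp [Sn]

lemma Sn_nonneg {m j : ℕ} (hm : 0 < m) (h : j ≤ m) : 0 ≤ Sn m j := by
  have hm' : (0 : ℝ) < m := by exact_mod_cast hm
  have hj : (j : ℝ) ≤ m := by exact_mod_cast h
  apply Real.sin_nonneg_of_nonneg_of_le_pi
  · unfold th; positivity
  · unfold th
    rw [mul_div_assoc', div_le_iff₀ hm']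
    nlinarith [Real.pi_pos]

lemma Sn_pos {m j : ℕ} (h0 : 0 < j) (h : j < m) : 0 < Sn m j := by
  have hm' : (0 : ℝ) < m := by exact_mod_cast (h0.trans h)
  have hj : (j : ℝ) < m := by exact_mod_cast h
  have hj0 : (0 : ℝ) < j := by exact_mod_cast h0
  apply Real.sin_pos_of_pos_of_lt_pi
  · unfold th; positivity
  · unfold th
    rw [mul_div_assoc', div_lt_iff₀ hm']
    nlinarith [Real.pi_pos]

lemma Sn_m {m : ℕ} (hm : 0 < m) : Sn m m = 0 := by
  have hm' : (m : ℝ) ≠ 0 := by exact_mod_cast hm.ne'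
  unfold Sn th
  rw [mul_div_cancel₀ _ hm']; simp

lemma lam_pos {m : ℕ} (hm : 3 ≤ m) : 0 < lam m := by
  have h1 := Sn_rec m 0
  have h2 := Sn_pos (m := m) (j := 2) (by omega) (by omega)
  have h3 := Sn_pos (m := m) (j := 1) (by omega) (by omega)
  rw [Sn_zero] at h1
  simp only [zero_add] at h1
  by_contra h
  nlinarith

/-- one step -/
noncomputable def sp (m : ℕ) (n : ℤ) (p : ℝ × ℝ) : ℝ × ℝ := (p.2 - n * lam m * p.1, -p.1)

noncomputable def col (m : ℕ) (l : List ℤ) : ℝ × ℝ := l.foldr (sp m) (1, 0)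

def Inv (m j : ℕ) (p : ℝ × ℝ) : Prop := Sn m (j + 1) * |p.2| ≤ |p.1| * Sn m j

lemma sp_ne {m : ℕ} {n : ℤ} {p : ℝ × ℝ} (h : p ≠ 0) : sp m n p ≠ 0 := by
  intro h'
  apply h
  unfold sp at h'
  have h1 : -p.1 = 0 := congrArg Prod.snd h'
  have h2 : p.2 - n * lam m * p.1 = 0 := congrArg Prod.fst h'
  have h3 : p.1 = 0 := by linarith
  rw [h3] at h2
  exact Prod.ext h3 (by simpa using h2)

lemma abs_int {n : ℤ} (hn : n ≠ 0) : (1 : ℝ) ≤ |(n : ℝ)| := by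
  have := Int.one_le_abs hn
  exact_mod_cast this

lemma Inv.step {m j : ℕ} (hm : 3 ≤ m) (hj : j + 1 ≤ m) {n : ℤ} (hn : n ≠ 0) {p : ℝ × ℝ}
    (h : Inv m j p) : Inv m (j + 1) (sp m n p) := by
  unfold Inv sp at *
  have hl := lam_pos hm
  have h0 := Sn_nonneg (by omega) hj
  have h1 : lam m * |p.1| - |p.2| ≤ |p.2 - n * lam m * p.1| := by
    have := abs_sub_abs_le_abs_sub (n * lam m * p.1) p.2
    rw [abs_sub_comm] at this
    rw [abs_mul, abs_mul, abs_of_pos hl] at this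
    have h2 := abs_int hn
    have h3 : lam m * |p.1| ≤ |(n : ℝ)| * lam m * |p.1| := by
      rw [mul_assoc]
      exact le_mul_of_one_le_left (by positivity) h2
    linarith
  simp only [abs_neg]
  rw [Sn_rec]
  nlinarith

/-- sign after a step -/
lemma Inv.sign {m j : ℕ} (hm : 3 ≤ m) (hj : j + 2 ≤ m) {n : ℤ} (hn : n ≠ 0) {p : ℝ × ℝ}
    (h : Inv m j p) : 0 ≤ (n : ℝ) * ((sp m n p).1 * (sp m n p).2) := by
  unfold Inv at h
  have hl := lam_pos hm
  have h0 := Sn_pos (m := m) (j := j + 1) (by omega) (by omega)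
  have h2 := Sn_nonneg (by omega) hj
  rw [Sn_rec] at h2
  have h3 : |p.2| ≤ lam m * |p.1| := by
    have : Sn m (j + 1) * |p.2| ≤ Sn m (j + 1) * (lam m * |p.1|) := by
      nlinarith [abs_nonneg p.1]
    exact le_of_mul_le_mul_left this h0
  have h4 := abs_int hn
  have h5 : (n : ℝ) * p.1 * p.2 ≤ |(n : ℝ)| * |p.1| * |p.2| := by
    rw [← abs_mul, ← abs_mul]; exact le_abs_self _
  have h6 : |(n : ℝ)| * |p.1| * |p.2| ≤ |(n : ℝ)| * |p.1| * (lam m * |p.1|) :=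
    mul_le_mul_of_nonneg_left h3 (by positivity)
  have h7 : |(n : ℝ)| * |p.1| * (lam m * |p.1|) = lam m * |(n : ℝ)| * p.1 ^ 2 := by
    rw [← sq_abs p.1]; ring
  have h8 : lam m * |(n : ℝ)| * p.1 ^ 2 ≤ lam m * (n : ℝ) ^ 2 * p.1 ^ 2 := by
    have : |(n : ℝ)| ≤ (n : ℝ) ^ 2 := by rw [← sq_abs (n : ℝ)]; nlinarith
    gcongr
  unfold sp
  simp only
  nlinarith

lemma Inv.turn {m : ℕ} (hm : 3 ≤ m) {n : ℤ} (hn : n ≠ 0) {p : ℝ × ℝ}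
    (h : (n : ℝ) * (p.1 * p.2) ≤ 0) : Inv m 1 (sp m n p) := by
  unfold Inv sp
  have hl := lam_pos hm
  have h1 := Sn_pos (m := m) (j := 1) (by omega) (by omega)
  rw [Sn_rec m 0, Sn_zero]
  simp only [abs_neg, zero_add, sub_zero]
  have h4 := abs_int hn
  have : lam m * |p.1| ≤ |p.2 - n * lam m * p.1| := by
    rw [← sq_le_sq₀ (by positivity) (abs_nonneg _)]
    rw [mul_pow, sq_abs, sq_abs]
    have : (1 : ℝ) ≤ (n : ℝ) ^ 2 := by rw [← sq_abs (n : ℝ)]; nlinarith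
    have h9 : lam m ^ 2 * p.1 ^ 2 * 1 ≤ lam m ^ 2 * p.1 ^ 2 * (n : ℝ) ^ 2 :=
      mul_le_mul_of_nonneg_left this (by positivity)
    nlinarith [mul_nonneg hl.le (neg_nonneg.2 h), sq_nonneg p.2]
  nlinarith

lemma col_ne (m : ℕ) (l : List ℤ) : col m l ≠ 0 := by
  induction l with
  | nil => simp [col]
  | cons n l ih => exact sp_ne ih

lemma col_inv {m : ℕ} (hm : 3 ≤ m) (l : List ℤ) (hl : ∀ n ∈ l, n ≠ 0) (h : l.length ≤ m) :
    Inv m l.length (col m l) := by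
  induction l with
  | nil => simp [Inv, col, Sn_zero]
  | cons n l ih =>
    exact (ih (fun n hn => hl n (by simp [hn])) (by simp at h; omega)).step hm (by simpa using h)
      (hl n (by simp))

lemma inv_ne {m j : ℕ} (hj : j + 1 < m) {p : ℝ × ℝ} (h : Inv m j p) (hp : p ≠ 0) :
    p.1 ≠ 0 := by
  intro h0
  unfold Inv at h
  have := Sn_pos (m := m) (j := j + 1) (by omega) hj
  rw [h0] at h
  simp at h
  apply hp
  refine Prod.ext h0 ?_
  simp only [Prod.snd_zero]
  by_contra h2
  have := mul_pos this (abs_pos.2 h2)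
  linarith

lemma col_ne0 {m : ℕ} (hm : 3 ≤ m) (l1 l2 : List ℤ) (h1 : ∀ n ∈ l1, n ≠ 0) (h2 : ∀ n ∈ l2, n ≠ 0)
    (k : ℕ) (hk : k + 2 ≤ m) (hl1 : l1.length = k + 1) (hl2 : l2.length = k)
    (hs : ∀ x ∈ l1.head?, ∀ y ∈ l2.getLast?, x * y < 0) : (col m (l2 ++ l1)).1 ≠ 0 := by
  rcases List.eq_nil_or_concat l2 with rfl | ⟨l2, y, rfl⟩
  · simp only [List.length_nil] at hl2
    subst hl2
    simp only [List.nil_append]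
    have := col_inv hm l1 h1 (by omega)
    rw [hl1] at this
    exact inv_ne (by omega) this (col_ne _ _)
  · cases l1 with
    | nil => simp at hl1
    | cons x l1 =>
      simp only [List.concat_eq_append] at *
      have hxy := hs x (by simp) y (by simp)
      simp only [List.length_cons, List.length_append, List.length_nil] at hl1 hl2
      have i1 := col_inv hm l1 (fun n hn => h1 n (by simp [hn])) (by omega)
      have s1 := i1.sign hm (by omega) (h1 x (by simp))
      have s2 : (y : ℝ) * ((col m (x :: l1)).1 * (col m (x :: l1)).2) ≤ 0 := by
        have hx0 : (x : ℝ) ≠ 0 := by exact_mod_cast h1 x (by simp)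
        have hxy' : (x : ℝ) * y < 0 := by exact_mod_cast hxy
        change 0 ≤ (x : ℝ) * ((col m (x :: l1)).1 * (col m (x :: l1)).2) at s1
        by_contra hc
        push Not at hc
        set w := (col m (x :: l1)).1 * (col m (x :: l1)).2
        have hw : w ≠ 0 := by rintro h; rw [h] at hc; simp at hc
        have : 0 < w ^ 2 := by positivity
        nlinarith [mul_nonneg s1 hc.le]
      have t1 := Inv.turn hm (h2 y (by simp)) s2
      have t2 : ∀ l : List ℤ, (∀ n ∈ l, n ≠ 0) → l.length + 1 ≤ m →
          Inv m (l.length + 1) (col m (l ++ (y :: x :: l1))) := by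
        intro l
        induction l with
        | nil => intro _ _; exact t1
        | cons n l ih =>
          intro hn hle
          simp only [List.length_cons] at hle
          exact (ih (fun n h => hn n (by simp [h])) (by omega)).step hm (by omega)
            (hn n (by simp))
      have t3 := t2 l2 (fun n h => h2 n (by simp [h])) (by omega)
      have := inv_ne (by omega) t3 (col_ne _ _)
      simpa using this

end Dih

namespace Dih

abbrev SL := Matrix.SpecialLinearGroup (Fin 2) ℝ
abbrev Pg := SL ⧸ Subgroup.center SL

def um (x : ℝ) : SL := ⟨!![1, x; 0, 1], by simp⟩
def lm (x : ℝ) : SL := ⟨!![1, 0; x, 1], by simp⟩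
def tau : SL := ⟨!![0, 1; -1, 0], by simp⟩

lemma um_add (x y : ℝ) : um (x + y) = um x * um y := by
  apply Subtype.ext
  rw [Matrix.SpecialLinearGroup.coe_mul]
  simp [um, add_comm]

def umHom : Multiplicative ℝ →* SL where
  toFun x := um x.toAdd
  map_one' := by
    apply Subtype.ext
    simp [um, Matrix.one_fin_two]
  map_mul' x y := um_add _ _

lemma um_zpow (x : ℝ) (n : ℤ) : um x ^ n = um (n * x) := by
  have := map_zpow umHom (Multiplicative.ofAdd x) n
  rw [← ofAdd_zsmul] at this
  simp only [zsmul_eq_mul] at this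
  exact this.symm

/-- entries of central elements -/
lemma center_of {g : SL} (c : ℝ) (h : g.1 = !![c, 0; 0, c]) : g ∈ Subgroup.center SL := by
  rw [Subgroup.mem_center_iff]
  intro x
  apply Subtype.ext
  rw [Matrix.SpecialLinearGroup.coe_mul, Matrix.SpecialLinearGroup.coe_mul]
  change x.1 * g.1 = g.1 * x.1
  rw [h]
  ext i j
  fin_cases i <;> fin_cases j <;> simp [Matrix.mul_apply, Fin.sum_univ_two, mul_comm]

lemma center_01 {g : SL} (h : g ∈ Subgroup.center SL) : g.1 0 1 = 0 := by
  rw [Subgroup.mem_center_iff] at h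
  have := h (lm 1)
  have h2 := congrArg (fun x : SL => x.1 0 0) this
  simp only [Matrix.SpecialLinearGroup.coe_mul] at h2
  simpa [Matrix.mul_apply, Fin.sum_univ_two, lm] using h2

noncomputable def Cm (m : ℕ) (n : ℤ) : SL := um (n * lam m) * tau

lemma Cm_val (m : ℕ) (n : ℤ) : (Cm m n).1 = !![-(n * lam m), 1; -1, 0] := by
  unfold Cm
  rw [Matrix.SpecialLinearGroup.coe_mul]
  simp [um, tau]

noncomputable def W0 (m : ℕ) (l : List ℤ) : SL := (l.map (Cm m)).prod

lemma W0_col (m : ℕ) (l : List ℤ) :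
    (W0 m l).1 0 0 = (col m l).1 ∧ (W0 m l).1 1 0 = (col m l).2 := by
  induction l with
  | nil => simp [W0, col]
  | cons n l ih =>
    have : W0 m (n :: l) = Cm m n * W0 m l := by simp [W0]
    rw [this, Matrix.SpecialLinearGroup.coe_mul]
    have e : col m (n :: l) = sp m n (col m l) := rfl
    have hC := Cm_val m n
    change ((Cm m n).1 * (W0 m l).1) 0 0 = _ ∧ ((Cm m n).1 * (W0 m l).1) 1 0 = _
    rw [hC, e]
    simp [Matrix.mul_apply, Fin.sum_univ_two, ih.1, ih.2, sp]
    ring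

noncomputable def Cp (m : ℕ) (n : ℤ) : Pg := (Cm m n : Pg)
noncomputable def W (m : ℕ) (l : List ℤ) : Pg := (l.map (Cp m)).prod
def tp : Pg := (tau : Pg)
noncomputable def Ap (m : ℕ) : Pg := (um (lam m) : Pg)

lemma W_eq (m : ℕ) (l : List ℤ) : W m l = (W0 m l : Pg) := by
  induction l with
  | nil => rfl
  | cons n l ih =>
    have h1 : W m (n :: l) = Cp m n * W m l := by simp [W]
    have h2 : W0 m (n :: l) = Cm m n * W0 m l := by simp [W0]
    rw [h1, h2, ih]; rfl

lemma W_app (m : ℕ) (l l' : List ℤ) : W m (l ++ l') = W m l * W m l' := by simp [W]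

lemma Cp_eq (m : ℕ) (n : ℤ) : Cp m n = Ap m ^ n * tp := by
  unfold Cp Cm
  rw [← um_zpow]; rfl

lemma tp2 : tp * tp = 1 := by
  have : tau * tau ∈ Subgroup.center SL := by
    apply center_of (-1)
    rw [Matrix.SpecialLinearGroup.coe_mul]
    simp [tau]
  exact (QuotientGroup.eq_one_iff _).2 this

lemma C_pow (m : ℕ) (k : ℕ) : ∃ s : ℝ, (s = 1 ∨ s = -1) ∧ Sn m 1 • ((Cm m 1) ^ (k + 1)).1 =
    s • !![Sn m (k + 2), -Sn m (k + 1); Sn m (k + 1), -Sn m k] := by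
  induction k with
  | zero =>
    refine ⟨-1, by simp, ?_⟩
    rw [zero_add, pow_one, Cm_val, Sn_rec, Sn_zero]
    ext i j
    fin_cases i <;> fin_cases j <;> simp [mul_comm]
  | succ k ih =>
    obtain ⟨s, hs, h⟩ := ih
    refine ⟨-s, by rcases hs with h | h <;> simp [h], ?_⟩
    rw [pow_succ', Matrix.SpecialLinearGroup.coe_mul]
    change Sn m 1 • ((Cm m 1).1 * ((Cm m 1) ^ (k + 1)).1) = _
    rw [← Matrix.mul_smul, h, Cm_val, Sn_rec m (k + 1), Sn_rec m k]
    ext i j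
    fin_cases i <;> fin_cases j <;> simp [Matrix.mul_apply, Fin.sum_univ_two] <;> ring

lemma C_m {m : ℕ} (hm : 3 ≤ m) : Cp m 1 ^ m = 1 := by
  obtain ⟨k, rfl⟩ : ∃ k, m = k + 1 := ⟨m - 1, by omega⟩
  obtain ⟨s, hs, h⟩ := C_pow (k + 1) k
  have h1 := Sn_pos (m := k + 1) (j := 1) (by omega) (by omega)
  have h2 := Sn_rec (k + 1) k
  rw [Sn_m (by omega)] at h h2
  have h3 : Cm (k + 1) 1 ^ (k + 1) ∈ Subgroup.center SL := by
    apply center_of ((Sn (k + 1) 1)⁻¹ * (s * (- Sn (k + 1) k)))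
    have h4 := congrArg (fun M => (Sn (k + 1) 1)⁻¹ • M) h
    simp only [smul_smul, inv_mul_cancel₀ h1.ne', one_smul] at h4
    rw [h4, h2]
    ext i j
    fin_cases i <;> fin_cases j <;> simp <;> ring
  exact (QuotientGroup.eq_one_iff _).2 h3

/-- the representation -/
noncomputable def f0 (m : ℕ) : FreeGroup Bool →* Pg :=
  FreeGroup.lift fun b => if b then tp * Ap m * tp else Ap m

lemma f0_false (m : ℕ) : f0 m (FreeGroup.of false) = Ap m := by simp [f0]
lemma f0_true (m : ℕ) : f0 m (FreeGroup.of true) = tp * Ap m * tp := by simp [f0]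

lemma tpx (x : Pg) : tp * (tp * x) = x := by rw [← mul_assoc, tp2, one_mul]

lemma f0_alt (m k : ℕ) : f0 m (altWord false true k) = Cp m 1 ^ k * tp ^ k ∧
    f0 m (altWord true false k) = tp * (Cp m 1 ^ k * tp ^ k) * tp := by
  induction k with
  | zero => simp [altWord, tp2]
  | succ k ih =>
    have hC : Cp m 1 = Ap m * tp := by rw [Cp_eq, zpow_one]
    constructor
    · rw [altWord, map_mul, ih.2, f0_false, pow_succ', pow_succ tp, hC]
      simp only [mul_assoc]
    · rw [altWord, map_mul, ih.1, f0_true, pow_succ', pow_succ tp, hC]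
      simp only [mul_assoc, tp2, mul_one]

lemma f0_rel {m : ℕ} (hm : 3 ≤ m) : f0 m (altWord false true m * (altWord true false m)⁻¹) = 1 := by
  rw [map_mul, map_inv, (f0_alt m m).1, (f0_alt m m).2, C_m hm, mul_inv_eq_one, one_mul,
    ← pow_succ', pow_succ, mul_assoc, tp2, mul_one]

def alt (x : Bool) : List ℤ → FreeGroup Bool
  | [] => 1
  | n :: l => FreeGroup.of x ^ n * alt (!x) l

lemma f0_altl (m : ℕ) (l : List ℤ) : f0 m (alt false l) = W m l * tp ^ l.length ∧
    f0 m (alt true l) = tp * (W m l * tp ^ l.length) * tp := by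
  induction l with
  | nil => simp [alt, W, tp2]
  | cons n l ih =>
    have hW : W m (n :: l) = Ap m ^ n * tp * W m l := by simp [W, Cp_eq]
    have hz : (tp * Ap m * tp) ^ n = tp * Ap m ^ n * tp := by
      have h1 : tp⁻¹ = tp := inv_eq_of_mul_eq_one_left tp2
      have := conj_zpow (a := tp) (b := Ap m) (i := n)
      rwa [h1] at this
    constructor
    · rw [alt, map_mul, map_zpow, Bool.not_false, ih.2, f0_false, hW, List.length_cons, pow_succ]
      simp only [mul_assoc]
    · rw [alt, map_mul, map_zpow, Bool.not_true, ih.1, f0_true, hW, List.length_cons, pow_succ, hz]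
      simp only [mul_assoc, tp2, mul_one]

/-- exponent sum -/
noncomputable def es : FreeGroup Bool →* Multiplicative ℤ := FreeGroup.lift fun _ => Multiplicative.ofAdd 1

lemma es_alt (x : Bool) (l : List ℤ) : es (alt x l) = Multiplicative.ofAdd l.sum := by
  induction l generalizing x with
  | nil => simp [alt]
  | cons n l ih =>
    rw [alt, map_mul, ih, map_zpow]
    simp only [es, FreeGroup.lift_apply_of, List.sum_cons, ofAdd_add]
    rw [← ofAdd_zsmul]; simp

lemma es_altWord (x y : Bool) (k : ℕ) : es (altWord x y k) = es (altWord y x k) := by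
  have : ∀ x y, es (altWord x y k) = Multiplicative.ofAdd 1 ^ k := by
    induction k with
    | zero => intro x y; simp [altWord]
    | succ k ih => intro x y; rw [altWord, map_mul, ih, pow_succ']; simp [es]
  rw [this, this]

end Dih

namespace Dih

lemma rot_ex (l : List ℤ) : ∀ x, x ≠ 0 → (∀ n ∈ l, n ≠ 0) → (∀ y ∈ x :: l, 0 < x * y) ∨
    ∃ u a b v, x :: l = u ++ a :: b :: v ∧ b * a < 0 := by
  induction l with
  | nil => intro x hx _; left; intro y hy; simp at hy; subst hy; exact mul_self_pos.2 hx
  | cons z l ih =>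
    intro x hx hl
    have hz := hl z (by simp)
    rcases lt_or_gt_of_ne (mul_ne_zero hx hz) with h | h
    · right
      exact ⟨[], x, z, l, rfl, by rwa [mul_comm]⟩
    · rcases ih z hz (fun n hn => hl n (by simp [hn])) with h1 | ⟨u, a, b, v, h1, h2⟩
      · left
        intro y hy
        rcases List.mem_cons.1 hy with rfl | hy
        · exact mul_self_pos.2 hx
        · have := h1 y hy
          have h3 : 0 < (x * y) * (z * z) := by
            have : (x * y) * (z * z) = (x * z) * (z * y) := by ring
            rw [this]; positivity
          exact (pos_iff_pos_of_mul_pos h3).2 (mul_self_pos.2 hz)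
      · right
        exact ⟨x :: u, a, b, v, by simp [h1], h2⟩

lemma mul_sum_pos (x : ℤ) (l : List ℤ) (h : ∀ y ∈ l, 0 < x * y) (hl : l ≠ []) : 0 < x * l.sum := by
  induction l with
  | nil => exact absurd rfl hl
  | cons y l ih =>
    rw [List.sum_cons, mul_add]
    have := h y (by simp)
    by_cases h0 : l = []
    · subst h0; simpa using this
    · have := ih (fun y hy => h y (by simp [hy])) h0
      linarith

lemma W_rot {m : ℕ} {u v : List ℤ} (h : W m (u ++ v) = 1) : W m (v ++ u) = 1 := by
  rw [W_app] at *
  rw [mul_eq_one_iff_eq_inv] at h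
  rw [h]; simp

lemma main_even {m k : ℕ} (hm : 3 ≤ m) (hk : k + 2 ≤ m) (l : List ℤ) (hl : ∀ n ∈ l, n ≠ 0)
    (hlen : l.length = 2 * (k + 1)) (hs : l.sum = 0) (hW : W m l = 1) : False := by
  cases l with
  | nil => simp at hlen
  | cons x l =>
    rcases rot_ex l x (hl x (by simp)) (fun n hn => hl n (by simp [hn])) with h | ⟨u, a, b, v, h, hab⟩
    · have := mul_sum_pos x _ h (by simp)
      rw [hs] at this; simp at this
    · rw [h] at hW hlen hl
      have hW' : W m ((b :: v) ++ (u ++ [a])) = 1 := W_rot (by simpa using hW)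
      have hnz : ∀ n ∈ (b :: v) ++ (u ++ [a]), n ≠ 0 := by
        intro n hn
        apply hl
        simp at hn ⊢
        tauto
      have hlen' : ((b :: v) ++ (u ++ [a])).length = 2 * (k + 1) := by
        simp at hlen ⊢; omega
      have hh : ((b :: v) ++ (u ++ [a])).head? = some b := rfl
      have ht : ((b :: v) ++ (u ++ [a])).getLast? = some a := by
        rw [← List.append_assoc]; exact List.getLast?_concat
      generalize (b :: v) ++ (u ++ [a]) = L at *
      have hd : L = L.take (k + 1) ++ L.drop (k + 1) := (List.take_append_drop _ _).symm
      have hl1 : (L.take (k + 1)).length = k + 1 := by simp; omega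
      have hl2 : (L.drop (k + 1)).length = k + 1 := by simp; omega
      generalize L.take (k + 1) = l1 at *
      generalize L.drop (k + 1) = l2' at *
      subst hd
      cases l2' with
      | nil => simp at hl2
      | cons y l2 =>
        have hc : (col m (l2 ++ l1)).1 ≠ 0 := by
          apply col_ne0 hm l1 l2 (fun n hn => hnz n (by simp [hn])) (fun n hn => hnz n (by simp [hn]))
            k hk hl1 (by simpa using hl2)
          intro p hp q hq
          have e1 : p = b := by
            rw [List.head?_append, hp] at hh
            simpa using hh
          have e2 : q = a := by
            cases l2 with
            | nil => simp at hq
            | cons z l2 =>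
              rw [List.getLast?_append] at ht
              simp only [List.getLast?_cons_cons] at ht
              rw [hq] at ht
              simpa using ht
          rw [e1, e2]; exact hab
        have hW2 : W m ((l2 ++ l1) ++ [y]) = 1 := by
          have := W_rot (u := l1 ++ [y]) (v := l2) (by simpa using hW')
          simpa using this
        rw [W_eq] at hW2
        have hz := center_01 ((QuotientGroup.eq_one_iff _).1 hW2)
        have e3 : W0 m ((l2 ++ l1) ++ [y]) = W0 m (l2 ++ l1) * Cm m y := by simp [W0, mul_assoc]
        rw [e3, Matrix.SpecialLinearGroup.coe_mul] at hz
        change ((W0 m (l2 ++ l1)).1 * (Cm m y).1) 0 1 = 0 at hz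
        rw [Cm_val] at hz
        simp [Matrix.mul_apply, Fin.sum_univ_two] at hz
        exact hc ((W0_col m _).1.symm.trans hz)

lemma main_cl {m : ℕ} (hm : 3 ≤ m) (N : ℕ) : ∀ (c : ℤ) (l : List ℤ), l.length ≤ N →
    (∀ n ∈ l, n ≠ 0) → (∃ k, l.length = 2 * k + 1 ∧ k + 1 ≤ m ∧ (c = 0 ∨ k + 2 ≤ m)) →
    c + l.sum = 0 → W m (c :: l) = 1 → False := by
  induction N with
  | zero => rintro c l h1 _ ⟨k, hk, -⟩; omega
  | succ N ih =>
    rintro c l hN hnz ⟨k, hk, hkm, hc⟩ hs hW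
    by_cases h0 : c = 0
    · subst h0
      cases l with
      | nil => simp at hk
      | cons x l =>
        rcases List.eq_nil_or_concat l with rfl | ⟨l', y, rfl⟩
        · simp at hs; exact hnz x (by simp) hs
        · simp only [List.concat_eq_append] at *
          simp only [List.length_cons, List.length_append, List.length_nil] at hk hN
          refine ih (x + y) l' (by omega) (fun n hn => hnz n (by simp [hn]))
            ⟨k - 1, by omega, by omega, by omega⟩ ?_ ?_
          · simp at hs; omega
          · have e : W m (0 :: x :: (l' ++ [y])) = Cp m 0 * Cp m x * W m l' * Cp m y := by
              simp [W, mul_assoc]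
            rw [e, Cp_eq, Cp_eq, Cp_eq, zpow_zero, one_mul] at hW
            have e2 : W m ((x + y) :: l') = Ap m ^ (x + y) * tp * W m l' := by simp [W, Cp_eq]
            have e3 : Ap m ^ (x + y) * tp * W m l' =
                (Ap m ^ y * tp) * (tp * (Ap m ^ x * tp) * W m l' * (Ap m ^ y * tp)) * (Ap m ^ y * tp)⁻¹ := by
              rw [add_comm x y, zpow_add]
              have : ∀ a b w g : Pg, b * a * tp * w = (b * tp) * (tp * (a * tp) * w * g) * g⁻¹ := by
                intro a b w g
                have : (b * tp) * (tp * (a * tp) * w * g) * g⁻¹ = b * (tp * tp) * a * tp * w := by group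
                rw [this, tp2, mul_one]
              exact this _ _ _ _
            rw [e2, e3, hW]; simp
    · refine main_even (k := k) hm (by tauto) (c :: l) ?_ (by simp [hk]; ring) (by simpa using hs) hW
      intro n hn
      rcases List.mem_cons.1 hn with rfl | h
      · exact h0
      · exact hnz n h

lemma alt_girth {m : ℕ} (hm : 3 ≤ m) (x : Bool) (l : List ℤ) (hl : ∀ n ∈ l, n ≠ 0) (h0 : l ≠ [])
    (hf : f0 m (alt x l) = 1) (he : es (alt x l) = 1) : 2 * m ≤ l.length := by
  by_contra hlt
  push Not at hlt
  have hs : l.sum = 0 := by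
    rw [es_alt] at he; exact ofAdd_eq_one.1 he
  have hW : W m l * tp ^ l.length = 1 := by
    cases x
    · rw [← (f0_altl m l).1]; exact hf
    · rw [(f0_altl m l).2] at hf
      have h2 : tp * (tp * (W m l * tp ^ l.length) * tp) * tp = 1 := by rw [hf, mul_one, tp2]
      rwa [mul_assoc tp (W m l * _), tpx, mul_assoc, tp2, mul_one] at h2
  rcases Nat.even_or_odd' l.length with ⟨k, hk | hk⟩
  · rw [hk, pow_mul, pow_two, tp2, one_pow, mul_one] at hW
    have : k ≠ 0 := by rintro rfl; exact h0 (List.length_eq_zero_iff.1 hk)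
    exact main_even (k := k - 1) hm (by omega) l hl (by omega) hs hW
  · rw [hk, pow_succ, pow_mul, pow_two, tp2, one_pow, one_mul] at hW
    refine main_cl hm l.length 0 l le_rfl hl ⟨k, hk, by omega, Or.inl rfl⟩ (by omega) ?_
    have e : W m (0 :: l) = tp * W m l := by simp [W, Cp_eq]
    rw [e, mul_eq_one_iff_eq_inv, inv_eq_of_mul_eq_one_right hW]

end Dih

section Syl
variable {σ : Type} [DecidableEq σ]

def syl (L : List (σ × Bool)) : ℕ := ((L.map Prod.fst).destutter (· ≠ ·)).length

lemma syl_mono {L L' : List (σ × Bool)} (h : L.Sublist L') : syl L ≤ syl L' := by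
  unfold syl
  exact (List.isChain_destutter _ _).length_le_length_destutter_ne
    ((List.destutter_sublist _ _).trans (h.map _))

lemma syl_append (L L' : List (σ × Bool)) : syl (L ++ L') ≤ syl L + syl L' := by
  unfold syl
  have h := List.destutter_sublist (· ≠ ·) ((L ++ L').map Prod.fst)
  have hc := List.isChain_destutter (· ≠ ·) ((L ++ L').map Prod.fst)
  rw [List.map_append] at *
  obtain ⟨c1, c2, he, h1, h2⟩ := List.sublist_append_iff.1 h
  rw [he] at hc ⊢
  rw [List.length_append]
  exact Nat.add_le_add (hc.left_of_append.length_le_length_destutter_ne h1)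
    (hc.right_of_append.length_le_length_destutter_ne h2)

lemma syl_zl (i : σ) (n : ℤ) : syl (zl i n) ≤ 1 := by
  unfold syl
  have h := List.destutter_sublist (· ≠ ·) ((zl i n).map Prod.fst)
  have hc := List.isChain_destutter (· ≠ ·) ((zl i n).map Prod.fst)
  have hm : ∀ x ∈ ((zl i n).map Prod.fst).destutter (· ≠ ·), x = i := by
    intro x hx
    obtain ⟨p, hp, rfl⟩ := List.mem_map.1 (h.subset hx)
    exact zl_fst hp
  generalize ((zl i n).map Prod.fst).destutter (· ≠ ·) = c at *
  match c, hc, hm with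
  | [], _, _ => simp
  | [a], _, _ => simp
  | a :: b :: c, hc, hm =>
    exfalso
    have := (List.isChain_cons_cons.1 hc).1
    rw [hm a (by simp), hm b (by simp)] at this
    exact this rfl

lemma syll_eq (x : FreeGroup σ) : syll x = syl x.toWord := rfl

lemma toWord_mk_red {L : List (σ × Bool)} (h : FreeGroup.IsReduced L) :
    (FreeGroup.mk L).toWord = L := by
  rw [FreeGroup.toWord_mk, h.reduce_eq]

lemma syll_mul (x y : FreeGroup σ) : syll (x * y) ≤ syll x + syll y :=
  (syl_mono (FreeGroup.toWord_mul_sublist x y)).trans (syl_append _ _)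

lemma syll_zpow (i : σ) (n : ℤ) : syll (FreeGroup.of i ^ n) ≤ 1 := by
  rw [← mk_zl, syll_eq, toWord_mk_red (zl_red i n)]
  exact syl_zl i n

end Syl

lemma syl_form (L : List (Bool × Bool)) : ∀ q : Bool × Bool, FreeGroup.IsReduced (q :: L) →
    ∃ (n : ℤ) (l : List ℤ), 0 < n * sg q.2 ∧ (∀ k ∈ l, k ≠ 0) ∧
      FreeGroup.mk (q :: L) = Dih.alt q.1 (n :: l) ∧ (n :: l).length = syl (q :: L) := by
  induction L with
  | nil =>
    rintro ⟨x, b⟩ -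
    refine ⟨sg b, [], by cases b <;> simp [sg], by simp, ?_, by simp [syl]⟩
    rw [mk_letter]; simp [Dih.alt]
  | cons p L ih =>
    rintro ⟨x, b⟩ h
    obtain ⟨y, c⟩ := p
    have h2 := List.isChain_cons_cons.1 h
    obtain ⟨n, l, h3, h4, h5, h6⟩ := ih (y, c) h2.2
    have hmk : FreeGroup.mk ((x, b) :: (y, c) :: L) =
        FreeGroup.of x ^ sg b * FreeGroup.mk ((y, c) :: L) := by
      rw [← mk_letter, FreeGroup.mul_mk]; rfl
    by_cases hxy : x = y
    · subst hxy
      have hb : b = c := h2.1 rfl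
      subst hb
      refine ⟨sg b + n, l, ?_, h4, ?_, ?_⟩
      · simp only at *
        have := sg_ne b
        have : 0 < sg b * sg b := by cases b <;> simp [sg]
        linarith [add_mul (sg b) n (sg b)]
      · rw [hmk, h5]; simp [Dih.alt, zpow_add, mul_assoc]
      · refine (h6 : l.length + 1 = _).trans ?_
        simp [syl, List.destutter_cons_cons, List.destutter_cons']
    · have hy : y = !x := by cases x <;> cases y <;> simp_all
      refine ⟨sg b, n :: l, by cases b <;> simp [sg], ?_, ?_, ?_⟩
      · intro k hk
        rcases List.mem_cons.1 hk with rfl | hk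
        · rintro rfl; simp at h3
        · exact h4 k hk
      · rw [hmk, h5]; simp [Dih.alt, hy]
      · rw [List.length_cons, h6]
        simp [syl, List.destutter_cons_cons, List.destutter_cons', hxy]

lemma syll_girth {m : ℕ} (hm : 3 ≤ m) {r : FreeGroup Bool} (hr : r ≠ 1)
    (h : twoGenArtinMk m r = 1) : 2 * m ≤ syll r := by
  have hmem : r ∈ Subgroup.normalClosure
      ({ altWord false true m * (altWord true false m)⁻¹ } : Set (FreeGroup Bool)) :=
    PresentedGroup.mk_eq_one_iff.1 h
  have h1 : Dih.f0 m r = 1 := by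
    have : Subgroup.normalClosure
      ({ altWord false true m * (altWord true false m)⁻¹ } : Set (FreeGroup Bool)) ≤ (Dih.f0 m).ker := by
      apply Subgroup.normalClosure_le_normal
      rintro _ rfl
      exact Dih.f0_rel hm
    exact this hmem
  have h2 : Dih.es r = 1 := by
    have : Subgroup.normalClosure
      ({ altWord false true m * (altWord true false m)⁻¹ } : Set (FreeGroup Bool)) ≤ Dih.es.ker := by
      apply Subgroup.normalClosure_le_normal
      rintro _ rfl
      change Dih.es _ = 1
      rw [map_mul, map_inv, Dih.es_altWord, mul_inv_cancel]
    exact this hmem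
  have hL := FreeGroup.isReduced_toWord (x := r)
  have h0 : r.toWord ≠ [] := by rwa [Ne, FreeGroup.toWord_eq_nil_iff]
  rw [syll_eq]
  have hmk : FreeGroup.mk r.toWord = r := FreeGroup.mk_toWord
  generalize r.toWord = L at *
  subst hmk
  cases L with
  | nil => exact absurd rfl h0
  | cons q L =>
    obtain ⟨n, l, h3, h4, h5, h6⟩ := syl_form L q hL
    rw [← h6]
    rw [h5] at h1 h2
    refine Dih.alt_girth hm q.1 (n :: l) ?_ (by simp) h1 h2
    intro k hk
    rcases List.mem_cons.1 hk with rfl | hk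
    · rintro rfl; simp at h3
    · exact h4 k hk

def eR (M : ℕ∞) : Set (FreeGroup Bool) :=
  { r | ∃ m : ℕ, M = m ∧ r = altWord false true m * (altWord true false m)⁻¹ }

lemma eR_girth {M : ℕ∞} (hM : 4 ≤ M) {r : FreeGroup Bool} (hr : r ≠ 1)
    (h : PresentedGroup.mk (eR M) r = 1) :
    ∃ m : ℕ, M = m ∧ twoGenArtinMk m r = 1 ∧ 4 ≤ m ∧ 2 * m ≤ syll r := by
  by_cases hT : M = ⊤
  · subst hT
    have : eR ⊤ = ∅ := by
      ext x; simp [eR]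
    rw [PresentedGroup.mk_eq_one_iff, this, Subgroup.normalClosure_empty] at h
    exact absurd h hr
  · lift M to ℕ using hT
    have : eR (M : ℕ∞) = { altWord false true M * (altWord true false M)⁻¹ } := by
      ext x; simp [eR]
    have h4 : 4 ≤ M := by exact_mod_cast hM
    rw [PresentedGroup.mk_eq_one_iff, this] at h
    have h' : twoGenArtinMk M r = 1 := PresentedGroup.mk_eq_one_iff.2 h
    exact ⟨M, rfl, h', h4, syll_girth (by omega) hr h'⟩

lemma four_girth {M : ℕ∞} (hM : 4 ≤ M) {x y : Bool} (hxy : x ≠ y) (p q r s : ℤ)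
    (h : PresentedGroup.mk (eR M) (FreeGroup.of x ^ p * FreeGroup.of y ^ q * FreeGroup.of x ^ r *
      FreeGroup.of y ^ s) = 1) :
    (q = 0 ∧ s = 0 ∧ p + r = 0) ∨ (p = 0 ∧ r = 0 ∧ q + s = 0) := by
  have h1 : FreeGroup.of x ^ p * FreeGroup.of y ^ q * FreeGroup.of x ^ r *
      FreeGroup.of y ^ s = 1 := by
    by_contra hne
    obtain ⟨m, -, -, h4, h5⟩ := eR_girth hM hne h
    have a1 := syll_mul (FreeGroup.of x ^ p * FreeGroup.of y ^ q * FreeGroup.of x ^ r) (FreeGroup.of y ^ s)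
    have a2 := syll_mul (FreeGroup.of x ^ p * FreeGroup.of y ^ q) (FreeGroup.of x ^ r)
    have a3 := syll_mul (FreeGroup.of x ^ p) (FreeGroup.of y ^ q)
    have b1 := syll_zpow x p
    have b2 := syll_zpow y q
    have b3 := syll_zpow x r
    have b4 := syll_zpow y s
    omega
  have key : ∀ z : Bool, (if x = z then p + r else 0) + (if y = z then q + s else 0) = 0 := by
    intro z
    have := congrArg (FreeGroup.lift fun t => Multiplicative.ofAdd (if t = z then (1:ℤ) else 0)) h1
    simp only [map_mul, map_zpow, FreeGroup.lift_apply_of, map_one, ← ofAdd_zsmul, ← ofAdd_add] at this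
    have := ofAdd_eq_one.1 this
    split_ifs at * <;> simp at this ⊢ <;> omega
  have k1 := key x
  have k2 := key y
  simp [hxy, Ne.symm hxy] at k1 k2
  by_cases hp : p = 0
  · right; omega
  by_cases hq : q = 0
  · left; omega
  exfalso
  have h2 : FreeGroup.mk (zl x p ++ (zl y q ++ [])) = FreeGroup.mk (zl y q ++ (zl x p ++ [])) := by
    rw [List.append_nil, List.append_nil, ← FreeGroup.mul_mk, ← FreeGroup.mul_mk, mk_zl, mk_zl]
    have e1 : r = -p := by omega
    have e2 : s = -q := by omega
    rw [e1, e2, zpow_neg, zpow_neg] at h1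
    have := mul_inv_eq_one.1 h1
    exact mul_inv_eq_iff_eq_mul.1 this
  have hr : ∀ (a b : Bool) (n k : ℤ), a ≠ b → k ≠ 0 → FreeGroup.IsReduced (zl a n ++ (zl b k ++ [])) := by
    intro a b n k hab hk
    apply zl_app_red
    · rw [List.append_nil]; exact zl_red _ _
    · intro t ht
      obtain ⟨c, hc⟩ := zl_head (k := b) hk []
      rw [hc] at ht
      rw [← (Option.some.inj ht)]
      exact hab.symm
  have h3 := red_eq (hr x y p q hxy hq) (hr y x q p hxy.symm hp) h2
  obtain ⟨c, hc⟩ := zl_head (k := x) hp (zl y q ++ [])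
  obtain ⟨d, hd⟩ := zl_head (k := y) hq (zl x p ++ [])
  rw [h3, hd] at hc
  simp at hc
  exact hxy hc.1.symm

section Cyc
variable {σ : Type} [DecidableEq σ]

lemma cyc_one {L : List (σ × Bool)} (h : FreeGroup.IsReduced L) :
    ∃ L', L' <:+: L ∧ FreeGroup.IsCyclicallyReduced L' ∧
      ∃ g, FreeGroup.mk L = g * FreeGroup.mk L' * g⁻¹ := by
  refine ⟨FreeGroup.reduceCyclically L, ?_, FreeGroup.reduceCyclically.isCyclicallyReduced h,
    FreeGroup.mk (FreeGroup.reduceCyclically.conjugator L), ?_⟩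
  · exact ⟨_, _, FreeGroup.reduceCyclically.conj_conjugator_reduceCyclically L⟩
  · rw [FreeGroup.inv_mk, FreeGroup.mul_mk, FreeGroup.mul_mk,
      FreeGroup.reduceCyclically.conj_conjugator_reduceCyclically]

lemma cyc_two (N : ℕ) : ∀ V U : List (σ × Bool), V.length + U.length ≤ N →
    FreeGroup.IsReduced V → FreeGroup.IsReduced U →
    ∃ V' U', V' <:+: V ∧ U' <:+: U ∧ FreeGroup.IsCyclicallyReduced (V' ++ U') ∧
      ∃ g, FreeGroup.mk (V ++ U) = g * FreeGroup.mk (V' ++ U') * g⁻¹ := by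
  induction N with
  | zero =>
    intro V U h _ _
    obtain rfl : V = [] := List.length_eq_zero_iff.1 (by omega)
    obtain rfl : U = [] := List.length_eq_zero_iff.1 (by omega)
    exact ⟨[], [], List.infix_rfl, List.infix_rfl, FreeGroup.IsCyclicallyReduced.nil, 1, by simp⟩
  | succ N ih =>
    intro V U hN hV hU
    by_cases hV0 : V = []
    · subst hV0
      obtain ⟨L', h1, h2, h3⟩ := cyc_one hU
      exact ⟨[], L', List.infix_rfl, h1, h2, h3⟩
    by_cases hU0 : U = []
    · subst hU0
      obtain ⟨L', h1, h2, h3⟩ := cyc_one hV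
      exact ⟨L', [], h1, List.infix_rfl, by simpa using h2, by simpa using h3⟩
    have canc : ∀ (x y : σ × Bool), x.1 = y.1 → x.2 ≠ y.2 →
        FreeGroup.mk [x] * FreeGroup.mk [y] = 1 := by
      rintro ⟨x, b⟩ ⟨y, c⟩ h1 h2
      simp only at h1 h2
      subst h1
      rw [mk_letter, mk_letter, ← zpow_add]
      cases b <;> cases c <;> simp_all [sg]
    -- inner cancellation
    by_cases hin : ∀ x ∈ V.getLast?, ∀ y ∈ U.head?, x.1 = y.1 → x.2 = y.2
    swap
    · push Not at hin
      obtain ⟨x, hx, y, hy, h1, h2⟩ := hin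
      obtain ⟨V1, rfl⟩ := List.getLast?_eq_some_iff.1 hx
      obtain ⟨U1, rfl⟩ := List.head?_eq_some_iff.1 hy
      obtain ⟨V', U', a1, a2, a3, g, a4⟩ := ih V1 U1 (by simp at hN; omega)
        (hV.infix ⟨[], [x], by simp⟩) (hU.infix ⟨[y], [], by simp⟩)
      refine ⟨V', U', a1.trans ⟨[], [x], by simp⟩, a2.trans ⟨[y], [], by simp⟩, a3, g, ?_⟩
      rw [← a4]
      have e : V1 ++ [x] ++ y :: U1 = V1 ++ ([x] ++ ([y] ++ U1)) := by simp
      rw [e, ← FreeGroup.mul_mk, ← FreeGroup.mul_mk, ← FreeGroup.mul_mk, ← mul_assoc (FreeGroup.mk [x]),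
        canc x y h1 h2, one_mul, FreeGroup.mul_mk]
    by_cases hout : ∀ x ∈ U.getLast?, ∀ y ∈ V.head?, x.1 = y.1 → x.2 = y.2
    swap
    · push Not at hout
      obtain ⟨x, hx, y, hy, h1, h2⟩ := hout
      obtain ⟨U1, rfl⟩ := List.getLast?_eq_some_iff.1 hx
      obtain ⟨V1, rfl⟩ := List.head?_eq_some_iff.1 hy
      obtain ⟨V', U', a1, a2, a3, g, a4⟩ := ih V1 U1 (by simp at hN; omega)
        (hV.infix ⟨[y], [], by simp⟩) (hU.infix ⟨[], [x], by simp⟩)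
      refine ⟨V', U', a1.trans ⟨[y], [], by simp⟩, a2.trans ⟨[], [x], by simp⟩, a3,
        FreeGroup.mk [y] * g, ?_⟩
      have e : y :: V1 ++ (U1 ++ [x]) = [y] ++ ((V1 ++ U1) ++ [x]) := by simp
      rw [e, ← FreeGroup.mul_mk, ← FreeGroup.mul_mk, a4, eq_inv_of_mul_eq_one_left (canc x y h1 h2)]
      group
    · refine ⟨V, U, List.infix_rfl, List.infix_rfl, ?_, 1, by simp⟩
      rw [FreeGroup.isCyclicallyReduced_iff]
      refine ⟨List.isChain_append.2 ⟨hV, hU, hin⟩, ?_⟩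
      intro x hx y hy
      rw [List.getLast?_append_of_ne_nil _ hU0] at hx
      rw [List.head?_append_of_ne_nil _ hV0] at hy
      exact hout x hx y hy

end Cyc

lemma red_map {σ τ : Type} {f : σ → τ} (hf : Function.Injective f) {L : List (σ × Bool)}
    (h : FreeGroup.IsReduced L) : FreeGroup.IsReduced (L.map fun p => (f p.1, p.2)) := by
  unfold FreeGroup.IsReduced at *
  rw [List.isChain_map]
  exact h.imp fun a b hab e => hab (hf e)

lemma syl_map {σ τ : Type} [DecidableEq σ] [DecidableEq τ] {f : σ → τ} (hf : Function.Injective f)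
    (L : List (σ × Bool)) : syl (L.map fun p => (f p.1, p.2)) = syl L := by
  unfold syl
  have : (L.map fun p => (f p.1, p.2)).map Prod.fst = (L.map Prod.fst).map f := by simp
  rw [this, ← List.map_destutter (R := (· ≠ ·)) (fun a _ b _ => hf.ne_iff.symm), List.length_map]

def gB {n : ℕ} (p : Fin n × Fin n) (x : Fin n) : Bool := decide (x = p.2)

lemma gB_ne {n : ℕ} {p : Fin n × Fin n} {i k : Fin n} (hi : i = p.1 ∨ i = p.2)
    (hk : k = p.1 ∨ k = p.2) (h : i ≠ k) : gB p i ≠ gB p k := by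
  unfold gB
  intro he
  have := decide_eq_decide.1 he
  rcases hi with hi | hi <;> rcases hk with hk | hk <;> grind

noncomputable def AS (n : ℕ) (M : Fin n → Fin n → ℕ∞) (hM : ∀ i j, i ≠ j → 4 ≤ M i j)
    (hn : 2 ≤ n) : Amal (Fin n) where
  E := {p : Fin n × Fin n // p.1 < p.2}
  Γ e := PresentedGroup (eR (M e.1.1 e.1.2))
  grp e := inferInstance
  mem e i := i = e.1.1 ∨ i = e.1.2
  a e i := PresentedGroup.mk _ (FreeGroup.of (gB e.1 i))
  join i j := by
    rcases lt_trichotomy i j with h | h | h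
    · exact ⟨⟨(i, j), h⟩, by simp⟩
    · subst h
      by_cases h0 : i.1 = 0
      · exact ⟨⟨(i, ⟨1, by omega⟩), by rw [Fin.lt_def]; simp [h0]⟩, by simp⟩
      · exact ⟨⟨(⟨0, by omega⟩, i), by rw [Fin.lt_def]; simp; omega⟩, by simp⟩
    · exact ⟨⟨(j, i), h⟩, by simp⟩
  ne e := ⟨e.1.1, by simp⟩
  uniq e f i j hij h1 h2 h3 h4 := by
    obtain ⟨⟨a, b⟩, h⟩ := e
    obtain ⟨⟨c, d⟩, h'⟩ := f
    have h5 : a < b := h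
    have h6 : c < d := h'
    have h7 : a = c ∧ b = d := by dsimp only at *; omega
    obtain ⟨rfl, rfl⟩ := h7
    rfl
  two e i j k h1 h2 h3 h4 := by omega
  oth e i h := by
    have := e.2
    rcases h with h | h
    · exact ⟨e.1.2, Or.inr rfl, by omega⟩
    · exact ⟨e.1.1, Or.inl rfl, by omega⟩
  girth e i k hi hk hik p q r s h := by
    refine four_girth (hM e.1.1 e.1.2 (ne_of_lt e.2)) (gB_ne hi hk hik) p q r s ?_
    rw [map_mul, map_mul, map_mul, map_zpow, map_zpow, map_zpow, map_zpow]
    exact h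

section
variable {n : ℕ} {M : Fin n → Fin n → ℕ∞} {hM : ∀ i j, i ≠ j → 4 ≤ M i j} {hn : 2 ≤ n}

lemma AS_lift (e : (AS n M hM hn).E) (x : FreeGroup (Fin n)) :
    FreeGroup.lift ((AS n M hM hn).a e) x =
      (PresentedGroup.mk (eR (M e.1.1 e.1.2)) (FreeGroup.map (gB e.1) x) : (AS n M hM hn).Γ e) := by
  have : FreeGroup.lift ((AS n M hM hn).a e) =
      (PresentedGroup.mk (eR (M e.1.1 e.1.2))).comp (FreeGroup.map (gB e.1)) := by
    ext i
    simp only [FreeGroup.lift_apply_of, MonoidHom.comp_apply, FreeGroup.map.of]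
    rfl
  rw [this]; rfl

lemma Phi_alt (e : (AS n M hM hn).E) (k : ℕ) : ∀ (i j : Fin n), (AS n M hM hn).mem e i →
    (AS n M hM hn).mem e j → Stg.Phi (AS n M hM hn) (altWord i j k) =
      Stg.Hm (AS n M hM hn) e (PresentedGroup.mk (eR (M e.1.1 e.1.2)) (altWord (gB e.1 i) (gB e.1 j) k)) := by
  induction k with
  | zero =>
    intro i j _ _
    simp only [altWord, map_one]
    exact (map_one (Stg.Hm (AS n M hM hn) e)).symm
  | succ k ih =>
    intro i j hi hj
    simp only [altWord]
    rw [map_mul, ih j i hj hi, Stg.Phi_of _ hi, map_mul]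
    exact (map_mul (Stg.Hm (AS n M hM hn) e) _ _).symm

lemma Phi_rel (hsym : ∀ i j, M i j = M j i) {w : FreeGroup (Fin n)} (h : artinMk n M w = 1) :
    Stg.Phi (AS n M hM hn) w = 1 := by
  have hmem : w ∈ Subgroup.normalClosure (artinRels n M) := PresentedGroup.mk_eq_one_iff.1 h
  have hlt : ∀ i j : Fin n, i < j → ∀ m : ℕ, M i j = m →
      Stg.Phi (AS n M hM hn) (altWord i j m) = Stg.Phi (AS n M hM hn) (altWord j i m) := by
    intro i j hij m hm
    rw [Phi_alt ⟨(i, j), hij⟩ m i j (Or.inl rfl) (Or.inr rfl),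
      Phi_alt ⟨(i, j), hij⟩ m j i (Or.inr rfl) (Or.inl rfl)]
    congr 1
    apply PresentedGroup.mk_eq_mk_of_mul_inv_mem
    refine ⟨m, hm, ?_⟩
    simp [gB, hij.ne]
  have : Subgroup.normalClosure (artinRels n M) ≤ (Stg.Phi (AS n M hM hn)).ker := by
    apply Subgroup.normalClosure_le_normal
    rintro _ ⟨i, j, hij, m, hm, rfl⟩
    change Stg.Phi (AS n M hM hn) _ = 1
    rw [map_mul, map_inv, mul_inv_eq_one]
    rcases lt_or_gt_of_ne hij with h | h
    · exact hlt i j h m hm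
    · exact (hlt j i h m (by rw [hsym]; exact hm)).symm
  exact this hmem

end

lemma triv_small {n : ℕ} (hn : ¬ 2 ≤ n) (M : Fin n → Fin n → ℕ∞) {w : FreeGroup (Fin n)}
    (h : artinMk n M w = 1) : w = 1 := by
  have he : artinRels n M = ∅ := by
    ext x
    simp only [artinRels, Set.mem_setOf_eq, Set.mem_empty_iff_false, iff_false]
    rintro ⟨i, j, hij, -⟩
    apply hij
    ext; omega
  have hmem : w ∈ Subgroup.normalClosure (artinRels n M) := PresentedGroup.mk_eq_one_iff.1 h
  rw [he, Subgroup.normalClosure_empty] at hmem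
  exact hmem

theorem artin_relator_subword (n : ℕ) (M : Fin n → Fin n → ℕ∞)
    (hsym : ∀ i j, M i j = M j i) (hM : ∀ i j, i ≠ j → 4 ≤ M i j)
    (w : FreeGroup (Fin n)) (hw : w ≠ 1) (hrel : artinMk n M w = 1) :
    ∃ (i j : Fin n) (mij : ℕ), i ≠ j ∧ M i j = (mij : ℕ∞) ∧
      ∃ r : FreeGroup Bool, r ≠ 1 ∧ CyclicallyReduced r ∧ twoGenArtinMk mij r = 1 ∧
        ∃ v u : FreeGroup (Fin n),
          (FreeGroup.map (fun b => if b then j else i) r).toWord =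
            v.toWord ++ u.toWord ∧
          v.toWord <:+: w.toWord ∧
          syll u ≤ 3 ∧ 2 * mij - 3 ≤ syll v := by
  by_cases hn : 2 ≤ n
  swap
  · exact absurd (triv_small hn M hrel) hw
  have hD : (AS n M hM hn).Dehn w.toWord := by
    apply Stg.Phi_dehn _ FreeGroup.isReduced_toWord
    · rwa [Ne, FreeGroup.toWord_eq_nil_iff]
    · rw [FreeGroup.mk_toWord]; exact Phi_rel hsym hrel
  obtain ⟨e, v, hv, hmem, j₁, j₂, j₃, n₁, n₂, n₃, m1, m2, m3, hev, hne⟩ := hD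
  have hvr : FreeGroup.IsReduced v := FreeGroup.isReduced_toWord.infix hv
  set z := FreeGroup.of j₁ ^ n₁ * FreeGroup.of j₂ ^ n₂ * FreeGroup.of j₃ ^ n₃ with hz
  have hgf : ∀ x, (AS n M hM hn).mem e x → (fun b => if b then e.1.2 else e.1.1) (gB e.1 x) = x := by
    intro x hx
    have := e.2
    rcases hx with rfl | rfl
    · simp [gB, this.ne]
    · simp [gB]
  have hinj : Function.Injective (fun b : Bool => if b then e.1.2 else e.1.1) := by
    have := e.2.ne
    intro a b hab
    cases a <;> cases b <;> simp_all
  set f : Bool → Fin n := fun b => if b then e.1.2 else e.1.1 with hf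
  set v' : List (Bool × Bool) := v.map fun p => (gB e.1 p.1, p.2) with hv'
  have hvv : (v'.map fun p => (f p.1, p.2)) = v := by
    rw [hv', List.map_map]
    conv_rhs => rw [← List.map_id v]
    apply List.map_congr_left
    intro p hp
    simp only [Function.comp]
    rw [hgf p.1 (hmem p hp)]; rfl
  have hv'r : FreeGroup.IsReduced v' := by
    rw [hv']
    unfold FreeGroup.IsReduced at hvr ⊢
    rw [List.isChain_map]
    refine List.IsChain.imp_of_mem_imp ?_ hvr
    intro a b ha hb hab h
    apply hab
    rw [← hgf _ (hmem a ha), ← hgf _ (hmem b hb)]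
    exact congrArg f h
  have hmapf : ∀ L : List (Bool × Bool), FreeGroup.map f (FreeGroup.mk L) =
      FreeGroup.mk (L.map fun p => (f p.1, p.2)) := fun L => FreeGroup.map.mk
  set z' := FreeGroup.map (gB e.1) z with hz'
  have hfz : FreeGroup.map f z' = z := by
    rw [hz', hz]
    simp only [map_mul, map_zpow, FreeGroup.map.of]
    rw [hgf _ m1, hgf _ m2, hgf _ m3]
  have hsz : syll z'⁻¹ ≤ 3 := by
    have : z'⁻¹ = FreeGroup.of (gB e.1 j₃) ^ (-n₃) * FreeGroup.of (gB e.1 j₂) ^ (-n₂) *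
        FreeGroup.of (gB e.1 j₁) ^ (-n₁) := by
      rw [hz', hz]
      simp only [map_mul, map_zpow, FreeGroup.map.of]
      group
    rw [this]
    have a2 := syll_mul (FreeGroup.of (gB e.1 j₃) ^ (-n₃) * FreeGroup.of (gB e.1 j₂) ^ (-n₂)) (FreeGroup.of (gB e.1 j₁) ^ (-n₁))
    have a3 := syll_mul (FreeGroup.of (gB e.1 j₃) ^ (-n₃)) (FreeGroup.of (gB e.1 j₂) ^ (-n₂))
    have b1 := syll_zpow (gB e.1 j₃) (-n₃)
    have b2 := syll_zpow (gB e.1 j₂) (-n₂)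
    have b3 := syll_zpow (gB e.1 j₁) (-n₁)
    omega
  obtain ⟨V, U, hV, hU, hcyc, g, hg⟩ := cyc_two _ v' z'⁻¹.toWord le_rfl hv'r FreeGroup.isReduced_toWord
  rw [← FreeGroup.mul_mk, FreeGroup.mk_toWord] at hg
  have hmk1 : PresentedGroup.mk (eR (M e.1.1 e.1.2)) (FreeGroup.mk v' * z'⁻¹) = 1 := by
    rw [map_mul, map_inv, mul_inv_eq_one]
    have e1 : FreeGroup.mk v' = FreeGroup.map (gB e.1) (FreeGroup.mk v) := FreeGroup.map.mk.symm
    rw [e1, hz']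
    have h1 := AS_lift (hM := hM) (hn := hn) e (FreeGroup.mk v)
    have h2 := AS_lift (hM := hM) (hn := hn) e z
    refine h1.symm.trans (Eq.trans ?_ h2)
    rw [← Amal.ev_lift, hev, hz]
    simp only [map_mul, map_zpow, FreeGroup.lift_apply_of]
  set r := FreeGroup.mk (V ++ U) with hr
  have hr1 : PresentedGroup.mk (eR (M e.1.1 e.1.2)) r = 1 := by
    rw [hg, map_mul, map_mul, map_inv, mul_inv_eq_one] at hmk1
    exact mul_eq_left.1 hmk1
  have hrne : r ≠ 1 := by
    intro h
    rw [h, mul_one, mul_inv_cancel, mul_inv_eq_one] at hg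
    apply hne
    rw [← hfz, ← hg, hmapf, hvv]
  obtain ⟨m, hMm, htw, -, hlen⟩ := eR_girth (hM e.1.1 e.1.2 e.2.ne) hrne hr1
  have hrw : r.toWord = V ++ U := toWord_mk_red hcyc.isReduced
  have hVr : FreeGroup.IsReduced V := hv'r.infix hV
  have hUr : FreeGroup.IsReduced U := FreeGroup.isReduced_toWord.infix hU
  refine ⟨e.1.1, e.1.2, m, e.2.ne, hMm, r, hrne, ?_, htw,
    FreeGroup.mk (V.map fun p => (f p.1, p.2)), FreeGroup.mk (U.map fun p => (f p.1, p.2)), ?_, ?_, ?_, ?_⟩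
  · intro x y hx hy hxy
    rw [hrw] at hx hy
    have := (FreeGroup.isCyclicallyReduced_iff.1 hcyc).2 y hy x hx (by rw [hxy])
    rw [hxy] at this
    simp at this
  · rw [toWord_mk_red (red_map hinj hVr), toWord_mk_red (red_map hinj hUr), ← List.map_append,
      ← toWord_mk_red (red_map hinj hcyc.isReduced), ← hmapf]
  · rw [toWord_mk_red (red_map hinj hVr)]
    refine List.IsInfix.trans ?_ hv
    rw [← hvv]
    exact hV.map _
  · rw [syll_eq, toWord_mk_red (red_map hinj hUr), syl_map hinj]
    exact (syl_mono hU.sublist).trans hsz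
  · rw [syll_eq, toWord_mk_red (red_map hinj hVr), syl_map hinj]
    have h1 := syl_append V U
    have h2 : syl U ≤ 3 := (syl_mono hU.sublist).trans hsz
    rw [syll_eq, hrw] at hlen
    omega
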